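/- arXiv:2411.04506 — 2 statements merged into one kernel-verified Lean document; each statement's English description precedes it below -/
import Mathlib

section
/- Let β = (π_ℓ)_{ℓ=1}^L be a chainable architecture. Then the set B^β is a closed subset of the space of complex matrices of the corresponding size, and for every matrix A of that size there exists B* ∈ B^β with ‖A − B*‖_F = E^β(A); equivalently, there exist factors X_ℓ ∈ D^{π_ℓ} (ℓ = 1,…,L) minimizing ‖A − X₁⋯X_L‖_F over all choices of such factors. -/
/-- A *pattern* is a tuple `(a, b, c, d)` of (positive) natural numbers. -/
structure Pattern where
  a : ℕ
  b : ℕ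
  c : ℕ
  d : ℕ

namespace Pattern

/-- The entries of a pattern are positive integers. -/
def Pos (π : Pattern) : Prop := 0 < π.a ∧ 0 < π.b ∧ 0 < π.c ∧ 0 < π.d

/-- Number of rows `a*b*d` of a `π`-factor. -/
def rows (π : Pattern) : ℕ := π.a * π.b * π.d

/-- Number of columns `a*c*d` of a `π`-factor. -/
def cols (π : Pattern) : ℕ := π.a * π.c * π.d

/-- `r(π₁, π₂) = a₁c₁/a₂ (= b₂d₂/d₁)`. -/
def rk (π₁ π₂ : Pattern) : ℕ := π₁.a * π₁.c / π₂.a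

/-- A pair of patterns is *chainable* if `a₁c₁/a₂ = b₂d₂/d₁` is a positive integer,
`a₁ ∣ a₂` and `d₂ ∣ d₁`. -/
def Chainable (π₁ π₂ : Pattern) : Prop :=
  π₂.a ∣ π₁.a * π₁.c ∧ π₁.d ∣ π₂.b * π₂.d ∧
    π₁.a * π₁.c / π₂.a = π₂.b * π₂.d / π₁.d ∧
    0 < π₁.a * π₁.c / π₂.a ∧ π₁.a ∣ π₂.a ∧ π₂.d ∣ π₁.d

/-- `π₁ * π₂ := (a₁, b₁d₁/d₂, a₂c₂/a₁, d₂)`. -/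
instance : Mul Pattern :=
  ⟨fun π₁ π₂ => ⟨π₁.a, π₁.b * π₁.d / π₂.d, π₂.a * π₂.c / π₁.a, π₂.d⟩⟩

/-- `‖π‖₀ := a*b*c*d`. -/
def norm0 (π : Pattern) : ℕ := π.a * π.b * π.c * π.d

end Pattern

open scoped Kronecker

/-- The flattening equivalence `(Fin a × Fin b) × Fin d ≃ Fin (a*b*d)`. -/
def kron3Equiv (a b d : ℕ) : (Fin a × Fin b) × Fin d ≃ Fin (a * b * d) :=
  (finProdFinEquiv.prodCongr (Equiv.refl (Fin d))).trans finProdFinEquiv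

/-- The support matrix `S_π = I_a ⊗ 1_{b×c} ⊗ I_d ∈ {0,1}^{abd × acd}`. -/
def Pattern.S (π : Pattern) : Matrix (Fin π.rows) (Fin π.cols) ℕ :=
  Matrix.reindex (kron3Equiv π.a π.b π.d) (kron3Equiv π.a π.c π.d)
    ((1 : Matrix (Fin π.a) (Fin π.a) ℕ) ⊗ₖ
      (Matrix.of fun _ _ => (1 : ℕ) : Matrix (Fin π.b) (Fin π.c) ℕ) ⊗ₖ
      (1 : Matrix (Fin π.d) (Fin π.d) ℕ))

/-- The support matrix `S_π`, extended by zero to an `ℕ × ℕ`-indexed array. -/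
def SpatN (π : Pattern) : ℕ → ℕ → ℕ := fun i j =>
  if h : i < π.rows ∧ j < π.cols then π.S ⟨i, h.1⟩ ⟨j, h.2⟩ else 0

/-- `X` is (the extension by zero of) a `π`-factor: it vanishes outside the support of `S_π`. -/
def IsFactorN (π : Pattern) (X : ℕ → ℕ → ℂ) : Prop :=
  ∀ i j, SpatN π i j = 0 → X i j = 0

/-- Product of matrices encoded as finitely supported `ℕ × ℕ`-indexed arrays. -/
noncomputable def nmul (f g : ℕ → ℕ → ℂ) : ℕ → ℕ → ℂ := fun i j => ∑' k, f i k * g k j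

/-- `nprod X k = X 0 * X 1 * ⋯ * X k`. -/
noncomputable def nprod (X : ℕ → ℕ → ℕ → ℂ) : ℕ → ℕ → ℕ → ℂ
  | 0 => X 0
  | k + 1 => nmul (nprod X k) (X (k + 1))

/-- Frobenius norm. -/
noncomputable def nfrob (f : ℕ → ℕ → ℂ) : ℝ := Real.sqrt (∑' i, ∑' j, ‖f i j‖ ^ 2)

/-- `A` is (the extension by zero of) a matrix of size `m × n`. -/
def SuppIn (m n : ℕ) (A : ℕ → ℕ → ℂ) : Prop := ∀ i j, A i j ≠ 0 → i < m ∧ j < n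

/-- The set `B^β` of butterfly matrices for the architecture `β = (π 0, …, π (L-1))`. -/
def Bset (π : ℕ → Pattern) (L : ℕ) : Set (ℕ → ℕ → ℂ) :=
  { M | ∃ X : ℕ → ℕ → ℕ → ℂ, (∀ ℓ < L, IsFactorN (π ℓ) (X ℓ)) ∧ M = nprod X (L - 1) }

/-- The approximation error `E^β(A) = inf_{B ∈ B^β} ‖A - B‖_F`. -/
noncomputable def Eerr (π : ℕ → Pattern) (L : ℕ) (A : ℕ → ℕ → ℂ) : ℝ :=
  sInf { e : ℝ | ∃ B ∈ Bset π L, e = nfrob (A - B) }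

open InnerProductSpace in
/-- Block Gram-Schmidt factorization: the columns of `Q` in one class of `g` are pairwise
orthogonal, and each is a unit vector unless it vanishes along with the matching row of `R`. -/
theorem exists_blockwise_orthonormal_factorization {N : ℕ} {γ : Type*}
    (g : Fin N → γ) (X : Matrix (Fin N) (Fin N) ℂ) :
    ∃ Q R : Matrix (Fin N) (Fin N) ℂ, X = Q * R ∧
      (∀ k k', R k k' ≠ 0 → g k = g k') ∧
      (∀ k k', g k = g k' → k ≠ k' → ∑ i, star (Q i k) * Q i k' = 0) ∧
      (∀ k, ∑ i, star (Q i k) * Q i k = 1 ∨ ((∀ i, Q i k = 0) ∧ ∀ k', R k k' = 0)) ∧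
      (∀ i k, Q i k ≠ 0 → ∃ k', g k' = g k ∧ X i k' ≠ 0) := by
  classical
  let f : γ → Fin N → EuclideanSpace ℂ (Fin N) :=
    fun c k => if g k = c then WithLp.toLp 2 (fun i => X i k) else 0
  let q : Fin N → EuclideanSpace ℂ (Fin N) := fun k => gramSchmidtNormed ℂ (f (g k)) k
  have inner_eq : ∀ u v : EuclideanSpace ℂ (Fin N), inner ℂ u v = ∑ i, star (u i) * v i := by
    intro u v
    simp [PiLp.inner_apply, mul_comm]
  have hz : ∀ c k, g k ≠ c → gramSchmidtNormed ℂ (f c) k = 0 := by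
    intro c k h
    have h0 : f c k = 0 := if_neg h
    have : gramSchmidt ℂ (f c) k = 0 := by
      rw [gramSchmidt_def, h0]; simp
    simp [gramSchmidtNormed, this]
  have hon : ∀ c, Orthonormal ℂ fun k : {k | gramSchmidtNormed ℂ (f c) k ≠ 0} =>
      gramSchmidtNormed ℂ (f c) k := fun c => gramSchmidtNormed_orthonormal' (f c)
  have hself : ∀ k, q k ≠ 0 → inner ℂ (q k) (q k) = 1 := by
    intro k hk
    have := (hon (g k)).1 ⟨k, hk⟩
    rw [inner_self_eq_norm_sq_to_K]
    simp only at this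
    simp [q, this]
  have horth : ∀ k k', g k = g k' → k ≠ k' → inner ℂ (q k) (q k') = 0 := by
    intro k k' hg hne
    by_cases h1 : q k = 0
    · simp [h1]
    by_cases h2 : q k' = 0
    · simp [h2]
    have h2' : gramSchmidtNormed ℂ (f (g k)) k' ≠ 0 := by rw [hg]; exact h2
    have := (hon (g k)).2 (i := ⟨k, h1⟩) (j := ⟨k', h2'⟩) (by simpa using hne)
    simpa [q, hg] using this
  have hmem : ∀ k', WithLp.toLp 2 (fun i => X i k') ∈
      Submodule.span ℂ (Set.range (gramSchmidtNormed ℂ (f (g k')))) := by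
    intro k'
    rw [span_gramSchmidtNormed_range, span_gramSchmidt]
    refine Submodule.subset_span ⟨k', ?_⟩
    simp [f]
  have hqmem : ∀ k, q k ∈ Submodule.span ℂ (Set.range (f (g k))) := by
    intro k
    rw [← span_gramSchmidt ℂ, ← span_gramSchmidtNormed_range]
    exact Submodule.subset_span ⟨k, rfl⟩
  refine ⟨Matrix.of fun i k => q k i, Matrix.of fun k k' => if g k = g k' then
      inner ℂ (q k) (WithLp.toLp 2 (fun i => X i k')) else 0, ?_, ?_, ?_, ?_, ?_⟩
  · ext i k'
    have key : ∀ x ∈ Submodule.span ℂ (Set.range (gramSchmidtNormed ℂ (f (g k')))),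
        x = ∑ k, (if g k = g k' then inner ℂ (q k) x else 0) • q k := by
      intro x hx
      induction hx using Submodule.span_induction with
      | mem x hx =>
        obtain ⟨l, rfl⟩ := hx
        by_cases hl : g l = g k'
        · rw [← hl]
          have hq : gramSchmidtNormed ℂ (f (g l)) l = q l := rfl
          rw [hq]
          rw [Finset.sum_eq_single l]
          · by_cases h : q l = 0
            · simp [h]
            · rw [if_pos rfl, hself l h, one_smul]
          · intro b _ hb
            split_ifs with h
            · simp [horth b l h hb]
            · simp
          · simp
        · simp [hz _ _ hl]
      | zero => simp
      | add x y _ _ hx hy =>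
        conv_lhs => rw [hx, hy]
        rw [← Finset.sum_add_distrib]
        refine Finset.sum_congr rfl fun k _ => ?_
        split_ifs
        · rw [inner_add_right, add_smul]
        · simp
      | smul a x _ hx =>
        conv_lhs => rw [hx]
        rw [Finset.smul_sum]
        refine Finset.sum_congr rfl fun k _ => ?_
        split_ifs
        · rw [inner_smul_right, mul_smul]
        · simp
    have := congrArg (fun v : EuclideanSpace ℂ (Fin N) => v i) (key _ (hmem k'))
    simp only [Matrix.mul_apply, Matrix.of_apply]
    refine this.trans ?_
    simp only [WithLp.ofLp_sum, Finset.sum_apply, PiLp.smul_apply, smul_eq_mul]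
    exact Finset.sum_congr rfl fun _ _ => mul_comm _ _
  · intro k k' h
    by_contra hg
    exact h (if_neg hg)
  · intro k k' hg hne
    simpa [inner_eq] using horth k k' hg hne
  · intro k
    by_cases h : q k = 0
    · right
      simp [h]
    · left
      exact (inner_eq _ _).symm.trans (hself k h)
  · intro i k h
    by_contra! hc
    have : ∀ x ∈ Submodule.span ℂ (Set.range (f (g k))), x i = 0 := by
      intro x hx
      induction hx using Submodule.span_induction with
      | mem x hx =>
        obtain ⟨l, rfl⟩ := hx
        by_cases hl : g l = g k
        · simp [f, hl, hc l hl]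
        · simp [f, hl]
      | zero => simp
      | add x y _ _ hx hy => simp [hx, hy]
      | smul a x _ hx => simp [hx]
    exact h (this _ (hqmem k))

/-- The product `X 0 * X 1 * ⋯ * X k` of square matrices. -/
noncomputable def mprod {N : ℕ} (X : ℕ → Matrix (Fin N) (Fin N) ℂ) : ℕ → Matrix (Fin N) (Fin N) ℂ
  | 0 => X 0
  | k + 1 => mprod X k * X (k + 1)

theorem mprod_succ' {N : ℕ} (X : ℕ → Matrix (Fin N) (Fin N) ℂ) (k : ℕ) :
    mprod X (k + 1) = X 0 * mprod (fun ℓ => X (ℓ + 1)) k := by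
  induction k with
  | zero => rfl
  | succ k ih => rw [mprod, ih, mprod, mul_assoc]

theorem mprod_congr {N : ℕ} {X Y : ℕ → Matrix (Fin N) (Fin N) ℂ} {m : ℕ}
    (h : ∀ ℓ ≤ m, X ℓ = Y ℓ) : mprod X m = mprod Y m := by
  induction m with
  | zero => exact h 0 le_rfl
  | succ k ih => rw [mprod, mprod, ih fun ℓ hℓ => h ℓ (by omega), h (k + 1) le_rfl]

theorem mprod_mul_left {N : ℕ} (R : Matrix (Fin N) (Fin N) ℂ)
    (X Z : ℕ → Matrix (Fin N) (Fin N) ℂ) (h0 : Z 0 = R * X 0) (h : ∀ ℓ, Z (ℓ + 1) = X (ℓ + 1))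
    (k : ℕ) : mprod Z k = R * mprod X k := by
  induction k with
  | zero => exact h0
  | succ k ih => rw [mprod, ih, mprod, h, mul_assoc]

theorem continuous_mprod {N : ℕ} (k : ℕ) :
    Continuous fun X : ℕ → Matrix (Fin N) (Fin N) ℂ => mprod X k := by
  induction k with
  | zero => exact continuous_apply 0
  | succ k ih => exact ih.matrix_mul (continuous_apply (k + 1))

/-- The squared Frobenius norm of a square matrix. -/
noncomputable def frobSq {N : ℕ} (M : Matrix (Fin N) (Fin N) ℂ) : ℝ := ∑ j, ∑ i, ‖M i j‖ ^ 2

theorem continuous_frobSq {N : ℕ} : Continuous (frobSq (N := N)) := by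
  unfold frobSq
  fun_prop

theorem frobSq_nonneg {N : ℕ} (M : Matrix (Fin N) (Fin N) ℂ) : 0 ≤ frobSq M :=
  Finset.sum_nonneg fun _ _ => Finset.sum_nonneg fun _ _ => by positivity

theorem norm_sq_le_frobSq {N : ℕ} (M : Matrix (Fin N) (Fin N) ℂ) (i j : Fin N) :
    ‖M i j‖ ^ 2 ≤ frobSq M :=
  (Finset.single_le_sum (f := fun i => ‖M i j‖ ^ 2) (fun _ _ => by positivity)
    (Finset.mem_univ i)).trans
  (Finset.single_le_sum (f := fun j => ∑ i, ‖M i j‖ ^ 2)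
    (fun _ _ => Finset.sum_nonneg fun _ _ => by positivity) (Finset.mem_univ j))

theorem frobSq_le {N : ℕ} (A M : Matrix (Fin N) (Fin N) ℂ) :
    frobSq M ≤ 2 * frobSq A + 2 * frobSq (A - M) := by
  simp only [frobSq, Finset.mul_sum, ← Finset.sum_add_distrib]
  refine Finset.sum_le_sum fun j _ => Finset.sum_le_sum fun i _ => ?_
  have h : ‖M i j‖ ≤ ‖A i j‖ + ‖(A - M) i j‖ := by
    have := norm_sub_le (A i j) ((A - M) i j)
    simpa using this
  nlinarith [sq_nonneg (‖A i j‖ - ‖(A - M) i j‖), norm_nonneg (M i j)]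

theorem sum_star_mul_self_eq_sum_norm_sq {N : ℕ} (v : Fin N → ℂ) :
    ∑ i, star (v i) * v i = ((∑ i, ‖v i‖ ^ 2 : ℝ) : ℂ) := by
  push_cast
  exact Finset.sum_congr rfl fun i _ => Complex.conj_mul' _

theorem frobSq_mul_of_orthonormal {N : ℕ} (Q Y : Matrix (Fin N) (Fin N) ℂ)
    (h1 : ∀ k j, Y k j ≠ 0 → ∑ i, star (Q i k) * Q i k = 1)
    (h2 : ∀ k k' j, Y k j ≠ 0 → Y k' j ≠ 0 → k ≠ k' → ∑ i, star (Q i k) * Q i k' = 0) :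
    frobSq (Q * Y) = frobSq Y := by
  refine Finset.sum_congr rfl fun j _ => ?_
  have : ((∑ i, ‖(Q * Y) i j‖ ^ 2 : ℝ) : ℂ) = ((∑ i, ‖Y i j‖ ^ 2 : ℝ) : ℂ) := by
    rw [← sum_star_mul_self_eq_sum_norm_sq (fun i => (Q * Y) i j),
      ← sum_star_mul_self_eq_sum_norm_sq (fun i => Y i j)]
    simp only [Matrix.mul_apply, star_sum, Finset.sum_mul_sum]
    rw [Finset.sum_comm]
    refine Finset.sum_congr rfl fun k _ => ?_
    rw [Finset.sum_comm, Finset.sum_eq_single k]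
    · by_cases hk : Y k j = 0
      · simp [hk]
      · rw [← one_mul (star (Y k j) * Y k j), ← h1 k j hk, Finset.sum_mul]
        refine Finset.sum_congr rfl fun i _ => ?_
        rw [star_mul']
        ring
    · intro k' _ hne
      by_cases hk : Y k j = 0
      · simp [hk]
      by_cases hk' : Y k' j = 0
      · simp [hk']
      rw [← zero_mul (star (Y k j) * Y k' j), ← h2 k k' j hk hk' hne.symm, Finset.sum_mul]
      refine Finset.sum_congr rfl fun i _ => ?_
      rw [star_mul']
      ring
    · simp
  exact_mod_cast this

/-- Supports `S 0, …, S m` of consecutive factors that are compatible with the row classes `α`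
and the column classes `δ`, so that orthonormalization can be done inside the joint classes. -/
structure ChainableSupports {N : ℕ} (m : ℕ) (S : ℕ → Fin N → Fin N → Prop)
    (α δ : ℕ → Fin N → ℕ) : Prop where
  col_class : ∀ ℓ ≤ m, ∀ i k k', S ℓ i k → S ℓ i k' → δ ℓ k = δ ℓ k'
  row_class : ∀ ℓ ≤ m, ∀ k k' j, S ℓ k j → S ℓ k' j → α ℓ k = α ℓ k'
  row_class_of_succ : ∀ ℓ < m, ∀ i i' k k', α (ℓ + 1) k = α (ℓ + 1) k' → S ℓ i k → S ℓ i' k' →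
    α ℓ i = α ℓ i'
  left_congr : ∀ ℓ < m, ∀ i k k', α (ℓ + 1) k = α (ℓ + 1) k' → δ ℓ k = δ ℓ k' →
    S ℓ i k → S ℓ i k'
  right_congr : ∀ ℓ < m, ∀ k k' j, α (ℓ + 1) k = α (ℓ + 1) k' → δ ℓ k = δ ℓ k' →
    S (ℓ + 1) k j → S (ℓ + 1) k' j

namespace ChainableSupports

theorem tail {N m : ℕ} {S : ℕ → Fin N → Fin N → Prop} {α δ : ℕ → Fin N → ℕ}
    (h : ChainableSupports (m + 1) S α δ) :
    ChainableSupports m (fun ℓ => S (ℓ + 1)) (fun ℓ => α (ℓ + 1)) (fun ℓ => δ (ℓ + 1)) where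
  col_class ℓ hℓ := h.col_class (ℓ + 1) (by omega)
  row_class ℓ hℓ := h.row_class (ℓ + 1) (by omega)
  row_class_of_succ ℓ hℓ := h.row_class_of_succ (ℓ + 1) (by omega)
  left_congr ℓ hℓ := h.left_congr (ℓ + 1) (by omega)
  right_congr ℓ hℓ := h.right_congr (ℓ + 1) (by omega)

theorem row_class_mprod {N m : ℕ} {S : ℕ → Fin N → Fin N → Prop} {α δ : ℕ → Fin N → ℕ}
    (h : ChainableSupports m S α δ) {X : ℕ → Matrix (Fin N) (Fin N) ℂ}
    (hX : ∀ ℓ ≤ m, ∀ i j, X ℓ i j ≠ 0 → S ℓ i j) {k k' j : Fin N}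
    (hk : mprod X m k j ≠ 0) (hk' : mprod X m k' j ≠ 0) : α 0 k = α 0 k' := by
  induction m generalizing S α δ X k k' with
  | zero => exact h.row_class 0 le_rfl _ _ j (hX 0 le_rfl _ _ hk) (hX 0 le_rfl _ _ hk')
  | succ m ih =>
    rw [mprod_succ', Matrix.mul_apply] at hk hk'
    obtain ⟨l, -, hl⟩ := Finset.exists_ne_zero_of_sum_ne_zero hk
    obtain ⟨l', -, hl'⟩ := Finset.exists_ne_zero_of_sum_ne_zero hk'
    have := ih h.tail (X := fun ℓ => X (ℓ + 1)) (fun ℓ hℓ => hX (ℓ + 1) (by omega))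
      (right_ne_zero_of_mul hl) (right_ne_zero_of_mul hl')
    exact h.row_class_of_succ 0 (by omega) _ _ l l' this
      (hX 0 (by omega) _ _ (left_ne_zero_of_mul hl)) (hX 0 (by omega) _ _ (left_ne_zero_of_mul hl'))

/-- Every product of factors with chainable supports is a product of such factors in which all but
the last have entries bounded by `1` and the last has the Frobenius norm of the product. -/
theorem exists_bounded_factors {N m : ℕ} {S : ℕ → Fin N → Fin N → Prop} {α δ : ℕ → Fin N → ℕ}
    (h : ChainableSupports m S α δ) (X : ℕ → Matrix (Fin N) (Fin N) ℂ)
    (hX : ∀ ℓ ≤ m, ∀ i j, X ℓ i j ≠ 0 → S ℓ i j) :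
    ∃ X' : ℕ → Matrix (Fin N) (Fin N) ℂ, (∀ ℓ ≤ m, ∀ i j, X' ℓ i j ≠ 0 → S ℓ i j) ∧
      mprod X' m = mprod X m ∧ (∀ ℓ < m, ∀ i j, ‖X' ℓ i j‖ ≤ 1) ∧
      frobSq (X' m) = frobSq (mprod X m) := by
  induction m generalizing S α δ X with
  | zero => exact ⟨X, hX, rfl, by simp, rfl⟩
  | succ m ih =>
    obtain ⟨Q, R, hQR, hR, horth, hunit, hQ⟩ :=
      exists_blockwise_orthonormal_factorization (fun k => (α 1 k, δ 0 k)) (X 0)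
    simp only [Prod.mk.injEq] at hR horth hQ
    have hQS : ∀ i k, Q i k ≠ 0 → S 0 i k := by
      intro i k hik
      obtain ⟨k', ⟨h1, h2⟩, hk'⟩ := hQ i k hik
      exact h.left_congr 0 (by omega) i k' k h1 h2 (hX 0 (by omega) _ _ hk')
    let Z : ℕ → Matrix (Fin N) (Fin N) ℂ := fun ℓ => if ℓ = 0 then R * X 1 else X (ℓ + 1)
    have hZ : ∀ ℓ ≤ m, ∀ i j, Z ℓ i j ≠ 0 → S (ℓ + 1) i j := by
      intro ℓ hℓ i j hij
      by_cases h0 : ℓ = 0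
      · subst h0
        simp only [Z, if_true, Matrix.mul_apply] at hij
        obtain ⟨l, -, hl⟩ := Finset.exists_ne_zero_of_sum_ne_zero hij
        obtain ⟨h1, h2⟩ := hR _ _ (left_ne_zero_of_mul hl)
        exact h.right_congr 0 (by omega) l i j h1.symm h2.symm
          (hX 1 (by omega) _ _ (right_ne_zero_of_mul hl))
      · simp only [Z, if_neg h0] at hij
        exact hX (ℓ + 1) (by omega) _ _ hij
    have hZprod : mprod Z m = R * mprod (fun ℓ => X (ℓ + 1)) m :=
      mprod_mul_left R _ Z (by simp [Z]) (fun ℓ => by simp [Z]) m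
    have hprod : mprod X (m + 1) = Q * mprod Z m := by
      rw [hZprod, mprod_succ', ← mul_assoc, ← hQR]
    obtain ⟨Z', hZ'S, hZ'prod, hZ'le, hZ'frob⟩ := ih h.tail Z hZ
    have hnz : ∀ k j, mprod Z m k j ≠ 0 → ∑ i, star (Q i k) * Q i k = 1 := by
      intro k j hkj
      refine (hunit k).resolve_right fun hk => hkj ?_
      simp [hZprod, Matrix.mul_apply, hk.2]
    have hnorm : ∀ i k, ‖Q i k‖ ≤ 1 := by
      intro i k
      rcases hunit k with hk | hk
      · rw [sum_star_mul_self_eq_sum_norm_sq (fun i => Q i k)] at hk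
        have h1 : ∑ i, ‖Q i k‖ ^ 2 = 1 := by exact_mod_cast hk
        have h2 := Finset.single_le_sum (f := fun i => ‖Q i k‖ ^ 2) (fun _ _ => by positivity)
          (Finset.mem_univ i)
        rw [h1] at h2
        exact (sq_le_one_iff₀ (norm_nonneg _)).1 h2
      · simp [hk.1 i]
    refine ⟨fun ℓ => Nat.casesOn ℓ Q Z', ?_, ?_, ?_, ?_⟩
    · rintro (_ | ℓ) hℓ i j hij
      · exact hQS i j hij
      · exact hZ'S ℓ (by omega) i j hij
    · rw [mprod_succ', hprod, ← hZ'prod]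
      rfl
    · rintro (_ | ℓ) hℓ i j
      · exact hnorm i j
      · exact hZ'le ℓ (by omega) i j
    · rw [hprod, frobSq_mul_of_orthonormal Q _ hnz, ← hZ'frob]
      intro k k' j hk hk' hne
      by_cases hδ : δ 0 k = δ 0 k'
      · exact horth k k' ⟨h.tail.row_class_mprod hZ hk hk', hδ⟩ hne
      · refine Finset.sum_eq_zero fun i _ => ?_
        by_contra hc
        refine hδ (h.col_class 0 (by omega) i k k' (hQS i k ?_) (hQS i k' ?_))
        · simpa using left_ne_zero_of_mul hc
        · exact right_ne_zero_of_mul hc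

/-- Products of factors with chainable supports and bounded Frobenius norm lie in a compact set of
such products. -/
theorem exists_isCompact {N m : ℕ} {S : ℕ → Fin N → Fin N → Prop} {α δ : ℕ → Fin N → ℕ}
    (h : ChainableSupports m S α δ) (C : ℝ) :
    ∃ T : Set (Matrix (Fin N) (Fin N) ℂ), IsCompact T ∧
      (∀ M ∈ T, ∃ X, (∀ ℓ ≤ m, ∀ i j, X ℓ i j ≠ 0 → S ℓ i j) ∧ M = mprod X m) ∧
      ∀ X, (∀ ℓ ≤ m, ∀ i j, X ℓ i j ≠ 0 → S ℓ i j) → frobSq (mprod X m) ≤ C → mprod X m ∈ T := by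
  classical
  let K : ℕ → Fin N → Fin N → Set ℂ := fun ℓ i j =>
    if ℓ ≤ m ∧ S ℓ i j then Metric.closedBall 0 (1 + |C|) else {0}
  have hK : ∀ ℓ i j, IsCompact (K ℓ i j) := by
    intro ℓ i j
    simp only [K]
    split_ifs
    · exact isCompact_closedBall _ _
    · exact isCompact_singleton
  refine ⟨(fun X => mprod X m) '' Set.univ.pi fun ℓ => (Set.univ.pi fun i =>
      (Set.univ.pi fun j => K ℓ i j) : Set (Matrix (Fin N) (Fin N) ℂ)), ?_, ?_, ?_⟩
  · refine IsCompact.image ?_ (continuous_mprod m)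
    exact isCompact_univ_pi fun ℓ => isCompact_univ_pi fun i => isCompact_univ_pi fun j => hK ℓ i j
  · rintro _ ⟨X, hX, rfl⟩
    refine ⟨X, fun ℓ hℓ i j hij => ?_, rfl⟩
    by_contra hS
    have := hX ℓ trivial i trivial j trivial
    simp only [K, hS, and_false, if_false] at this
    exact hij this
  · intro X hX hC
    obtain ⟨X', hS, hprod, hle, hfrob⟩ := h.exists_bounded_factors X hX
    refine ⟨fun ℓ => if ℓ ≤ m then X' ℓ else 0, ?_, ?_⟩
    · intro ℓ _ i _ j _
      by_cases hℓ : ℓ ≤ m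
      · by_cases hij : S ℓ i j
        · simp only [K, hℓ, hij, and_self, if_true, mem_closedBall_zero_iff]
          rcases hℓ.lt_or_eq with hlt | rfl
          · linarith [hle ℓ hlt i j, abs_nonneg C]
          · have := norm_sq_le_frobSq (X' ℓ) i j
            nlinarith [le_abs_self C, abs_nonneg C, norm_nonneg (X' ℓ i j)]
        · have h0 : X' ℓ i j = 0 := by
            by_contra hc
            exact hij (hS ℓ hℓ i j hc)
          simp [K, hℓ, hij, h0]
      · simp [K, hℓ]
    · rw [← hprod]
      exact mprod_congr fun ℓ hℓ => if_pos hℓ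

theorem isClosed_products {N m : ℕ} {S : ℕ → Fin N → Fin N → Prop} {α δ : ℕ → Fin N → ℕ}
    (h : ChainableSupports m S α δ) :
    IsClosed {M : Matrix (Fin N) (Fin N) ℂ |
      ∃ X, (∀ ℓ ≤ m, ∀ i j, X ℓ i j ≠ 0 → S ℓ i j) ∧ M = mprod X m} := by
  refine isClosed_of_closure_subset fun M hM => ?_
  obtain ⟨T, hT, hTsub, hmem⟩ := h.exists_isCompact (frobSq M + 1)
  refine hTsub M (hT.isClosed.closure_eq ▸ ?_)
  have hU : IsOpen {M' : Matrix (Fin N) (Fin N) ℂ | frobSq M' < frobSq M + 1} :=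
    isOpen_lt continuous_frobSq continuous_const
  have hMU := hU.inter_closure ⟨show frobSq M < frobSq M + 1 by linarith, hM⟩
  refine closure_mono ?_ hMU
  rintro _ ⟨hlt, X, hX, rfl⟩
  exact hmem X hX (le_of_lt hlt)

theorem exists_minimizer {N m : ℕ} {S : ℕ → Fin N → Fin N → Prop} {α δ : ℕ → Fin N → ℕ}
    (h : ChainableSupports m S α δ) (A : Matrix (Fin N) (Fin N) ℂ) :
    ∃ X, (∀ ℓ ≤ m, ∀ i j, X ℓ i j ≠ 0 → S ℓ i j) ∧
      ∀ Y, (∀ ℓ ≤ m, ∀ i j, Y ℓ i j ≠ 0 → S ℓ i j) →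
        frobSq (A - mprod X m) ≤ frobSq (A - mprod Y m) := by
  obtain ⟨T, hT, hTsub, hmem⟩ := h.exists_isCompact (4 * frobSq A)
  have hzero : mprod (fun _ => (0 : Matrix (Fin N) (Fin N) ℂ)) m = 0 := by
    cases m <;> simp [mprod]
  have h0 : (0 : Matrix (Fin N) (Fin N) ℂ) ∈ T := by
    have := hmem (fun _ => 0) (by simp)
    rw [hzero] at this
    refine this ?_
    have : frobSq (0 : Matrix (Fin N) (Fin N) ℂ) = 0 := by simp [frobSq]
    linarith [frobSq_nonneg A]
  have hcont : Continuous fun M => frobSq (A - M) :=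
    continuous_frobSq.comp (continuous_const.sub continuous_id)
  obtain ⟨M, hM, hmin⟩ := hT.exists_isMinOn ⟨0, h0⟩ hcont.continuousOn
  obtain ⟨X, hX, rfl⟩ := hTsub M hM
  refine ⟨X, hX, fun Y hY => ?_⟩
  by_cases hle : frobSq (A - mprod Y m) ≤ frobSq A
  · exact hmin (hmem Y hY (by linarith [frobSq_le A (mprod Y m)]))
  · have h1 : frobSq (A - mprod X m) ≤ frobSq (A - 0) := hmin h0
    rw [sub_zero] at h1
    linarith

end ChainableSupports

theorem SpatN_ne_zero_iff (π : Pattern) (i j : ℕ) :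
    SpatN π i j ≠ 0 ↔ i < π.rows ∧ j < π.cols ∧
      i / (π.b * π.d) = j / (π.c * π.d) ∧ i % π.d = j % π.d := by
  unfold SpatN
  split_ifs with h
  · have hS : π.S ⟨i, h.1⟩ ⟨j, h.2⟩ =
        (if i / π.d / π.b = j / π.d / π.c then 1 else 0) * 1 *
          (if i % π.d = j % π.d then 1 else 0) := by
      let x := (kron3Equiv π.a π.b π.d).symm ⟨i, h.1⟩
      let y := (kron3Equiv π.a π.c π.d).symm ⟨j, h.2⟩
      change (1 : Matrix _ _ ℕ) x.1.1 y.1.1 * 1 * (1 : Matrix _ _ ℕ) x.2 y.2 = _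
      simp only [Matrix.one_apply, Fin.ext_iff]
      rfl
    rw [hS, Nat.div_div_eq_div_mul, Nat.div_div_eq_div_mul, mul_comm π.d, mul_comm π.d]
    simp [h.1, h.2, and_comm]
  · simp only [ne_eq, not_true_eq_false, false_iff]
    exact fun hc => h ⟨hc.1, hc.2.1⟩

theorem Pattern.Chainable.col_block_eq {π₁ π₂ : Pattern} (h : π₁.Chainable π₂) (h₁ : π₁.Pos) :
    π₁.c * π₁.d = π₂.b * π₂.d * (π₂.a / π₁.a) := by
  obtain ⟨⟨r, hr⟩, ⟨s, hs⟩, hrs, -, ⟨t, ht⟩, -⟩ := h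
  obtain ⟨ha, -, hc, hd⟩ := h₁
  have ha2 : 0 < π₂.a := by
    rcases Nat.eq_zero_or_pos π₂.a with h0 | h0
    · rw [h0, zero_mul] at hr
      exact absurd hr (by positivity)
    · exact h0
  rw [hr, hs, Nat.mul_div_cancel_left _ ha2, Nat.mul_div_cancel_left _ hd] at hrs
  subst hrs
  rw [ht, Nat.mul_div_cancel_left _ ha, hs]
  rw [ht, mul_assoc] at hr
  rw [Nat.eq_of_mul_eq_mul_left ha hr]
  ring

theorem Pattern.Chainable.cols_eq {π₁ π₂ : Pattern} (h : π₁.Chainable π₂) (h₁ : π₁.Pos) :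
    π₁.cols = π₂.a * (π₂.b * π₂.d) := by
  rw [Pattern.cols, mul_assoc, h.col_block_eq h₁]
  obtain ⟨t, ht⟩ := h.2.2.2.2.1
  rw [ht, Nat.mul_div_cancel_left _ h₁.1]
  ring

theorem Pattern.Chainable.div_eq {π₁ π₂ : Pattern} (h : π₁.Chainable π₂) (h₁ : π₁.Pos) {k k' : ℕ}
    (hk : k / (π₂.b * π₂.d) = k' / (π₂.b * π₂.d)) :
    k / (π₁.c * π₁.d) = k' / (π₁.c * π₁.d) := by
  rw [h.col_block_eq h₁, ← Nat.div_div_eq_div_mul, hk, Nat.div_div_eq_div_mul]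

theorem Pattern.Chainable.lt_cols {π₁ π₂ : Pattern} (h : π₁.Chainable π₂) (h₁ : π₁.Pos)
    (h₂ : π₂.Pos) {k k' : ℕ} (hk : k / (π₂.b * π₂.d) = k' / (π₂.b * π₂.d)) (hlt : k < π₁.cols) :
    k' < π₁.cols := by
  have hpos : 0 < π₂.b * π₂.d := Nat.mul_pos h₂.2.1 h₂.2.2.2
  rw [h.cols_eq h₁, ← Nat.div_lt_iff_lt_mul hpos] at hlt ⊢
  rwa [← hk]

theorem chainableSupports_of_chainable {N m : ℕ} {π : ℕ → Pattern}
    (hPos : ∀ ℓ < m + 1, (π ℓ).Pos)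
    (hch : ∀ ℓ, ℓ + 1 < m + 1 → Pattern.Chainable (π ℓ) (π (ℓ + 1))) :
    ChainableSupports m (fun ℓ (i j : Fin N) => SpatN (π ℓ) i j ≠ 0)
      (fun ℓ k => k / ((π ℓ).b * (π ℓ).d)) (fun ℓ k => k % (π ℓ).d) := by
  simp only [SpatN_ne_zero_iff]
  constructor
  · rintro ℓ hℓ i k k' ⟨-, -, -, h⟩ ⟨-, -, -, h'⟩
    exact h.symm.trans h'
  · rintro ℓ hℓ k k' j ⟨-, -, h, -⟩ ⟨-, -, h', -⟩
    exact h.trans h'.symm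
  · rintro ℓ hℓ i i' k k' hk ⟨-, -, h, -⟩ ⟨-, -, h', -⟩
    exact h.trans (((hch ℓ (by omega)).div_eq (hPos ℓ (by omega)) hk).trans h'.symm)
  · rintro ℓ hℓ i k k' hα hδ ⟨h1, h2, h3, h4⟩
    have hc := hch ℓ (by omega)
    have hp := hPos ℓ (by omega)
    exact ⟨h1, hc.lt_cols hp (hPos (ℓ + 1) (by omega)) hα h2, h3.trans (hc.div_eq hp hα),
      h4.trans hδ⟩
  · rintro ℓ hℓ k k' j hα hδ ⟨h1, h2, h3, h4⟩
    have hc := hch ℓ (by omega)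
    have hp := hPos ℓ (by omega)
    refine ⟨?_, h2, hα.symm.trans h3, Eq.trans ?_ h4⟩
    · have hcols : (π (ℓ + 1)).rows = (π ℓ).cols := by
        rw [hc.cols_eq hp, Pattern.rows, mul_assoc]
      rw [hcols] at h1 ⊢
      exact hc.lt_cols hp (hPos (ℓ + 1) (by omega)) hα h1
    · have hd := hc.2.2.2.2.2
      rw [← Nat.mod_mod_of_dvd (k' : ℕ) hd, ← hδ, Nat.mod_mod_of_dvd _ hd]

/-- Extension by zero of a square matrix to an `ℕ × ℕ`-indexed array. -/
def extendZero {N : ℕ} (M : Matrix (Fin N) (Fin N) ℂ) : ℕ → ℕ → ℂ := fun i j =>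
  if h : i < N ∧ j < N then M ⟨i, h.1⟩ ⟨j, h.2⟩ else 0

/-- The upper left `N × N` corner of an `ℕ × ℕ`-indexed array. -/
def corner (N : ℕ) (f : ℕ → ℕ → ℂ) : Matrix (Fin N) (Fin N) ℂ := Matrix.of fun i j => f i j

theorem corner_extendZero {N : ℕ} (M : Matrix (Fin N) (Fin N) ℂ) : corner N (extendZero M) = M := by
  ext i j
  simp [corner, extendZero]

theorem corner_sub (N : ℕ) (f g : ℕ → ℕ → ℂ) : corner N (f - g) = corner N f - corner N g := rfl

theorem continuous_corner (N : ℕ) : Continuous (corner N) :=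
  continuous_matrix fun i j => (continuous_apply (j : ℕ)).comp (continuous_apply (i : ℕ))

theorem SuppIn.ext_corner {N : ℕ} {f g : ℕ → ℕ → ℂ} (hf : SuppIn N N f) (hg : SuppIn N N g)
    (h : corner N f = corner N g) : f = g := by
  ext i j
  by_cases hij : i < N ∧ j < N
  · exact congrFun (congrFun h ⟨i, hij.1⟩) ⟨j, hij.2⟩
  · rw [not_imp_comm.1 (hf i j) hij, not_imp_comm.1 (hg i j) hij]

theorem SuppIn.sub {m n : ℕ} {f g : ℕ → ℕ → ℂ} (hf : SuppIn m n f) (hg : SuppIn m n g) :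
    SuppIn m n (f - g) := by
  intro i j h
  by_contra hij
  exact h (by simp [not_imp_comm.1 (hf i j) hij, not_imp_comm.1 (hg i j) hij])

theorem isClosed_suppIn (m n : ℕ) : IsClosed {f | SuppIn m n f} := by
  have : {f | SuppIn m n f} =
      ⋂ (i : ℕ) (j : ℕ) (_ : ¬(i < m ∧ j < n)), {f : ℕ → ℕ → ℂ | f i j = 0} := by
    ext f
    simp only [SuppIn, Set.mem_ofPred_eq, Set.mem_iInter]
    exact forall₂_congr fun i j => not_imp_comm
  rw [this]
  exact isClosed_iInter fun i => isClosed_iInter fun j => isClosed_iInter fun _ =>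
    isClosed_eq ((continuous_apply j).comp (continuous_apply i)) continuous_const

theorem nmul_eq_sum {N : ℕ} {f : ℕ → ℕ → ℂ} (hf : SuppIn N N f) (g : ℕ → ℕ → ℂ) (i j : ℕ) :
    nmul f g i j = ∑ k : Fin N, f i k * g k j := by
  rw [Fin.sum_univ_eq_sum_range (fun k => f i k * g k j) N]
  refine tsum_eq_sum fun k hk => ?_
  have : f i k = 0 := by
    by_contra h
    exact hk (Finset.mem_range.2 (hf i k h).2)
  rw [this, zero_mul]

theorem SuppIn.nmul {N : ℕ} {f g : ℕ → ℕ → ℂ} (hf : SuppIn N N f) (hg : SuppIn N N g) :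
    SuppIn N N (nmul f g) := by
  intro i j h
  rw [nmul_eq_sum hf] at h
  obtain ⟨k, -, hk⟩ := Finset.exists_ne_zero_of_sum_ne_zero h
  exact ⟨(hf _ _ (left_ne_zero_of_mul hk)).1, (hg _ _ (right_ne_zero_of_mul hk)).2⟩

theorem corner_nmul {N : ℕ} {f : ℕ → ℕ → ℂ} (hf : SuppIn N N f) (g : ℕ → ℕ → ℂ) :
    corner N (nmul f g) = corner N f * corner N g := by
  ext i j
  simp [corner, nmul_eq_sum hf, Matrix.mul_apply]

theorem SuppIn.nprod {N m : ℕ} {X : ℕ → ℕ → ℕ → ℂ} (hX : ∀ ℓ ≤ m, SuppIn N N (X ℓ)) :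
    SuppIn N N (nprod X m) := by
  induction m with
  | zero => exact hX 0 le_rfl
  | succ m ih => exact (ih fun ℓ hℓ => hX ℓ (by omega)).nmul (hX (m + 1) le_rfl)

theorem corner_nprod {N m : ℕ} {X : ℕ → ℕ → ℕ → ℂ} (hX : ∀ ℓ ≤ m, SuppIn N N (X ℓ)) :
    corner N (nprod X m) = mprod (fun ℓ => corner N (X ℓ)) m := by
  induction m with
  | zero => rfl
  | succ m ih =>
    rw [nprod, mprod, corner_nmul (SuppIn.nprod fun ℓ hℓ => hX ℓ (by omega)),
      ih fun ℓ hℓ => hX ℓ (by omega)]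

theorem nfrob_eq_sqrt_frobSq {N : ℕ} {f : ℕ → ℕ → ℂ} (hf : SuppIn N N f) :
    nfrob f = Real.sqrt (frobSq (corner N f)) := by
  have hz : ∀ i j, ¬(i < N ∧ j < N) → f i j = 0 := fun i j => not_imp_comm.1 (hf i j)
  have hrow : ∀ i, ∑' j, ‖f i j‖ ^ 2 = ∑ j : Fin N, ‖f i j‖ ^ 2 := by
    intro i
    rw [Fin.sum_univ_eq_sum_range (fun j => ‖f i j‖ ^ 2) N]
    refine tsum_eq_sum fun j hj => ?_
    rw [hz i j fun h => hj (Finset.mem_range.2 h.2)]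
    simp
  have hsum : ∑' i, ∑ j : Fin N, ‖f i j‖ ^ 2 = ∑ i : Fin N, ∑ j : Fin N, ‖f i j‖ ^ 2 := by
    rw [Fin.sum_univ_eq_sum_range (fun i => ∑ j : Fin N, ‖f i j‖ ^ 2) N]
    refine tsum_eq_sum fun i hi => Finset.sum_eq_zero fun j _ => ?_
    rw [hz i j fun h => hi (Finset.mem_range.2 h.1)]
    simp
  rw [nfrob, tsum_congr hrow, hsum, Finset.sum_comm]
  rfl

theorem IsFactorN.suppIn {π : Pattern} {N : ℕ} (hr : π.rows ≤ N) (hc : π.cols ≤ N)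
    {X : ℕ → ℕ → ℂ} (hX : IsFactorN π X) : SuppIn N N X := by
  intro i j h
  have := (SpatN_ne_zero_iff π i j).1 fun h0 => h (hX i j h0)
  exact ⟨this.1.trans_le hr, this.2.1.trans_le hc⟩

theorem isFactorN_extendZero {π : Pattern} {N : ℕ} {M : Matrix (Fin N) (Fin N) ℂ}
    (hM : ∀ i j, M i j ≠ 0 → SpatN π i j ≠ 0) : IsFactorN π (extendZero M) := by
  intro i j h
  unfold extendZero
  split_ifs with hij
  · by_contra hc
    exact hM _ _ hc h
  · rfl

theorem Bset_eq_corner_preimage {π : ℕ → Pattern} {N m : ℕ}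
    (hN : ∀ ℓ ≤ m, (π ℓ).rows ≤ N ∧ (π ℓ).cols ≤ N) :
    Bset π (m + 1) = {f | SuppIn N N f} ∩ corner N ⁻¹' {M | ∃ X,
      (∀ ℓ ≤ m, ∀ i j, X ℓ i j ≠ 0 → SpatN (π ℓ) (i : Fin N) (j : Fin N) ≠ 0) ∧
        M = mprod X m} := by
  ext f
  constructor
  · rintro ⟨X, hX, rfl⟩
    have hS : ∀ ℓ ≤ m, SuppIn N N (X ℓ) := fun ℓ hℓ =>
      (hX ℓ (by omega)).suppIn (hN ℓ hℓ).1 (hN ℓ hℓ).2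
    exact ⟨SuppIn.nprod hS, fun ℓ => corner N (X ℓ),
      fun ℓ hℓ i j h h0 => h (hX ℓ (by omega) _ _ h0), corner_nprod hS⟩
  · rintro ⟨hf, X, hX, hfX⟩
    have hF : ∀ ℓ < m + 1, IsFactorN (π ℓ) (extendZero (X ℓ)) := fun ℓ hℓ =>
      isFactorN_extendZero (hX ℓ (by omega))
    have hS : ∀ ℓ ≤ m, SuppIn N N (extendZero (X ℓ)) := fun ℓ hℓ =>
      (hF ℓ (by omega)).suppIn (hN ℓ hℓ).1 (hN ℓ hℓ).2
    refine ⟨fun ℓ => extendZero (X ℓ), hF, hf.ext_corner (SuppIn.nprod hS) ?_⟩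
    simp only [Nat.add_sub_cancel]
    rw [hfX, corner_nprod hS]
    simp only [corner_extendZero]

/-- **Theorem (existence of an optimum).** For a chainable architecture `β`, the set `B^β`
is closed, and for every matrix `A` of the appropriate size the butterfly approximation
problem admits a minimizer: there are factors `X ℓ ∈ D^{π ℓ}` with
`‖A - X 0 ⋯ X (L-1)‖_F = E^β(A)`. -/
theorem butterfly_optimum_exists (L : ℕ) (hL : 1 ≤ L) (π : ℕ → Pattern)
    (hPos : ∀ ℓ < L, (π ℓ).Pos)
    (hch : ∀ ℓ, ℓ + 1 < L → Pattern.Chainable (π ℓ) (π (ℓ + 1)))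
    (A : ℕ → ℕ → ℂ) (hA : SuppIn (π 0).rows (π (L - 1)).cols A) :
    IsClosed (Bset π L) ∧
    ∃ X : ℕ → ℕ → ℕ → ℂ, (∀ ℓ < L, IsFactorN (π ℓ) (X ℓ)) ∧
      nfrob (A - nprod X (L - 1)) = Eerr π L A := by
  obtain ⟨m, rfl⟩ : ∃ m, L = m + 1 := ⟨L - 1, by omega⟩
  obtain ⟨N, hN⟩ : ∃ N, ∀ ℓ ≤ m, (π ℓ).rows ≤ N ∧ (π ℓ).cols ≤ N := by
    refine ⟨(Finset.range (m + 1)).sup fun ℓ => max (π ℓ).rows (π ℓ).cols, fun ℓ hℓ => ?_⟩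
    exact max_le_iff.1 (Finset.le_sup (f := fun ℓ => max (π ℓ).rows (π ℓ).cols)
      (Finset.mem_range.2 (by omega)))
  have hS := chainableSupports_of_chainable (N := N) hPos hch
  have hB := Bset_eq_corner_preimage hN
  refine ⟨?_, ?_⟩
  · rw [hB]
    exact (isClosed_suppIn N N).inter (hS.isClosed_products.preimage (continuous_corner N))
  · have hAN : SuppIn N N A := fun i j h =>
      ⟨(hA i j h).1.trans_le (hN 0 (by omega)).1, (hA i j h).2.trans_le (hN m le_rfl).2⟩
    obtain ⟨Y, hY, hmin⟩ := hS.exists_minimizer (corner N A)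
    have hmem : extendZero (mprod Y m) ∈ Bset π (m + 1) := by
      rw [hB]
      refine ⟨fun i j h => ?_, Y, hY, corner_extendZero _⟩
      by_contra hij
      exact h (dif_neg hij)
    have hle : ∀ B ∈ Bset π (m + 1), nfrob (A - extendZero (mprod Y m)) ≤ nfrob (A - B) := by
      intro B hBmem
      rw [hB] at hBmem hmem
      obtain ⟨hBN, Z, hZ, hBZ⟩ := hBmem
      rw [nfrob_eq_sqrt_frobSq (hAN.sub hmem.1), nfrob_eq_sqrt_frobSq (hAN.sub hBN), corner_sub,
        corner_sub, corner_extendZero, hBZ]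
      exact Real.sqrt_le_sqrt (hmin Z hZ)
    have hleast : IsLeast {e : ℝ | ∃ B ∈ Bset π (m + 1), e = nfrob (A - B)}
        (nfrob (A - extendZero (mprod Y m))) := by
      refine ⟨⟨_, hmem, rfl⟩, ?_⟩
      rintro _ ⟨B, hBmem, rfl⟩
      exact hle B hBmem
    obtain ⟨X, hX, hXeq⟩ := hmem
    refine ⟨X, hX, ?_⟩
    rw [← hXeq]
    exact hleast.csInf_eq.symm
end

section
/- Let β = (π_ℓ)_{ℓ=1}^L be a non-redundant chainable architecture of depth L ≥ 2. Then for every matrix A of the appropriate size there exist factors X_ℓ ∈ D^{π_ℓ} (ℓ = 1,…,L) such that ‖A − X₁⋯X_L‖_F ≤ Σ_{s=1}^{L−1} E^{β_s}(A). -/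
open scoped Kronecker

/-- Partial products of patterns: `pprod π q k = π q * π (q+1) * ⋯ * π (q+k)`. -/
def pprod (π : ℕ → Pattern) (q : ℕ) : ℕ → Pattern
  | 0 => π q
  | k + 1 => pprod π q k * π (q + k + 1)

/-- The two-pattern architecture `(p, q)`. -/
def pairArch (p q : Pattern) : ℕ → Pattern := fun ℓ => if ℓ = 0 then p else q

/-- The error `E^{β_s}(A)` of the split architecture
`β_s = (π 1 * ⋯ * π s, π (s+1) * ⋯ * π L)` (here `s` counts the factors in the left part). -/
noncomputable def Esplit (π : ℕ → Pattern) (L s : ℕ) (A : ℕ → ℕ → ℂ) : ℝ :=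
  Eerr (pairArch (pprod π 0 (s - 1)) (pprod π s (L - 1 - s))) 2 A

/-- A chainable pair is *redundant* if `r(π₁,π₂) ≥ min (b₁, c₂)`. -/
def RedundantPair (π₁ π₂ : Pattern) : Prop := min π₁.b π₂.c ≤ Pattern.rk π₁ π₂

noncomputable section
namespace Butterfly

open Finset

section Orthogonal

variable {E K : Type*} [NormedAddCommGroup E] [InnerProductSpace ℂ E]

/-- A finite family of pairwise orthogonal vectors, each of which is zero or a unit vector. -/
def PartialOrthonormal (s : Finset K) (u : K → E) : Prop :=
  (∀ k ∈ s, u k = 0 ∨ ‖u k‖ = 1) ∧ ∀ k ∈ s, ∀ l ∈ s, k ≠ l → inner ℂ (u k) (u l) = 0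

variable {s : Finset K} {u : K → E}

lemma PartialOrthonormal.norm_sum_sq_le (hu : PartialOrthonormal s u) (v : K → ℂ) :
    ‖∑ k ∈ s, v k • u k‖ ^ 2 ≤ ∑ k ∈ s, ‖v k‖ ^ 2 := by
  classical
  have h : ‖∑ k ∈ s, v k • u k‖ ^ 2 = ∑ k ∈ s, ‖v k • u k‖ ^ 2 := by
    have : ((‖∑ k ∈ s, v k • u k‖ ^ 2 : ℝ) : ℂ) = ((∑ k ∈ s, ‖v k • u k‖ ^ 2 : ℝ) : ℂ) := by
      push_cast
      rw [← Complex.coe_algebraMap, ← inner_self_eq_norm_sq_to_K (𝕜 := ℂ), sum_inner]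
      refine sum_congr rfl fun k hk => ?_
      rw [inner_sum, sum_eq_single_of_mem k hk, inner_self_eq_norm_sq_to_K]
      · intro l hl hlk
        rw [inner_smul_left, inner_smul_right, hu.2 k hk l hl hlk.symm]; simp
    exact_mod_cast this
  rw [h]
  refine sum_le_sum fun k hk => ?_
  rcases hu.1 k hk with h0 | h1
  · simp [h0]
  · simp [norm_smul, h1]

lemma PartialOrthonormal.inner_sub_proj (hu : PartialOrthonormal s u) (x : E) {l : K}
    (hl : l ∈ s) : inner ℂ (u l) (x - ∑ k ∈ s, inner ℂ (u k) x • u k) = 0 := by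
  classical
  rw [inner_sub_right, inner_sum, sum_eq_single_of_mem l hl]
  · rw [inner_smul_right, inner_self_eq_norm_sq_to_K]
    rcases hu.1 l hl with h0 | h1
    · simp [h0]
    · simp [h1]
  · intro k hk hkl
    rw [inner_smul_right, hu.2 l hl k hk hkl.symm, mul_zero]

lemma PartialOrthonormal.norm_sub_proj_le (hu : PartialOrthonormal s u) (x : E) {y : E}
    (hy : y ∈ Submodule.span ℂ (u '' s)) :
    ‖x - ∑ k ∈ s, inner ℂ (u k) x • u k‖ ≤ ‖x - y‖ := by
  set p := ∑ k ∈ s, inner ℂ (u k) x • u k with hp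
  have hpm : p ∈ Submodule.span ℂ (u '' s) := Submodule.sum_mem _ fun k hk =>
    Submodule.smul_mem _ _ (Submodule.subset_span ⟨k, hk, rfl⟩)
  have hmem : ∀ z ∈ Submodule.span ℂ (u '' s), inner ℂ (x - p) z = 0 := by
    intro z hz
    induction hz using Submodule.span_induction with
    | mem z h =>
      obtain ⟨l, hl, rfl⟩ := h
      rw [← inner_conj_symm, hu.inner_sub_proj x hl, map_zero]
    | zero => simp
    | add a b _ _ ha hb => rw [inner_add_right, ha, hb, add_zero]
    | smul c a _ ha => rw [inner_smul_right, ha, mul_zero]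
  have h0 := hmem (p - y) (Submodule.sub_mem _ hpm hy)
  have h1 := norm_add_sq_eq_norm_sq_add_norm_sq_of_inner_eq_zero _ _ h0
  rw [sub_add_sub_cancel] at h1
  nlinarith [norm_nonneg (x - y), norm_nonneg (x - p), norm_nonneg (p - y)]

lemma PartialOrthonormal.sum_norm_inner_sq_le (hu : PartialOrthonormal s u) (x : E) :
    ∑ k ∈ s, ‖inner ℂ (u k) x‖ ^ 2 ≤ ‖x‖ ^ 2 := by
  set p := ∑ k ∈ s, inner ℂ (u k) x • u k with hp
  have hx : inner ℂ p x = ((∑ k ∈ s, ‖inner ℂ (u k) x‖ ^ 2 : ℝ) : ℂ) := by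
    rw [hp, sum_inner]
    push_cast
    refine sum_congr rfl fun k _ => ?_
    rw [inner_smul_left, ← Complex.normSq_eq_conj_mul_self, Complex.normSq_eq_norm_sq]
    norm_cast
  have h1 := hu.norm_sum_sq_le fun k => inner ℂ (u k) x
  have h2 := norm_inner_le_norm (𝕜 := ℂ) p x
  rw [hx, Complex.norm_real, Real.norm_of_nonneg (by positivity)] at h2
  rw [← hp] at h1
  nlinarith [norm_nonneg p, norm_nonneg x, sq_nonneg (‖p‖ - ‖x‖)]

end Orthogonal

section Existence

variable {C : Type*} {n p : ℕ}

/-- For every pair of block factors there is a family of rows, orthogonal within every class, that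
spans the rows of the right factor class by class. -/
lemma exists_rows_span (cls : Fin n → C) (QS : Fin n → Fin p → Prop)
    (hQ : ∀ k l, cls k = cls l → ∀ j, QS k j → QS l j)
    (q : Fin n → EuclideanSpace ℂ (Fin p)) (hq : ∀ k j, q k j ≠ 0 → QS k j) :
    ∃ y : Fin n → EuclideanSpace ℂ (Fin p), (∀ k j, y k j ≠ 0 → QS k j) ∧
      (∀ k, y k = 0 ∨ ‖y k‖ = 1) ∧
      (∀ k l, cls k = cls l → k ≠ l → inner ℂ (y k) (y l) = 0) ∧
      ∀ k, q k ∈ Submodule.span ℂ (y '' {l | cls l = cls k}) := by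
  classical
  let f : C → Fin n → EuclideanSpace ℂ (Fin p) := fun c k => if cls k = c then q k else 0
  let g : C → Fin n → EuclideanSpace ℂ (Fin p) := fun c => InnerProductSpace.gramSchmidtNormed ℂ (f c)
  have hspan : ∀ c, Submodule.span ℂ (Set.range (g c)) = Submodule.span ℂ (Set.range (f c)) :=
    fun c => by
      rw [InnerProductSpace.span_gramSchmidtNormed_range, InnerProductSpace.span_gramSchmidt]
  have hg0 : ∀ c k, cls k ≠ c → g c k = 0 := by
    intro c k hk
    have h0 : f c k = 0 := if_neg hk
    have h1 : InnerProductSpace.gramSchmidt ℂ (f c) k = 0 := by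
      rw [InnerProductSpace.gramSchmidt_def, h0]
      simp
    simp only [g, InnerProductSpace.gramSchmidtNormed, h1, smul_zero]
  refine ⟨fun k => g (cls k) k, ?_, ?_, ?_, ?_⟩
  · intro k j
    have hmem : g (cls k) k ∈ Submodule.span ℂ (Set.range (f (cls k))) := by
      rw [← hspan]; exact Submodule.subset_span ⟨k, rfl⟩
    by_contra! hcon
    obtain ⟨hne, hnot⟩ := hcon
    apply hne
    clear hne
    generalize g (cls k) k = v at hmem
    induction hmem using Submodule.span_induction with
    | mem z h =>
      obtain ⟨l, rfl⟩ := h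
      by_cases hl : cls l = cls k
      · simp only [f, hl, if_true]
        by_contra hlj
        exact hnot (hQ l k hl j (hq l j hlj))
      · simp [f, hl]
    | zero => simp
    | add a b _ _ ha hb => simp [ha, hb]
    | smul c a _ ha => simp [ha]
  · intro k
    by_cases h : g (cls k) k = 0
    · exact Or.inl h
    · exact Or.inr (InnerProductSpace.gramSchmidtNormed_unit_length' h)
  · intro k l hkl hne
    have := InnerProductSpace.gramSchmidt_orthogonal ℂ (f (cls l)) hne
    simp only [hkl, g, InnerProductSpace.gramSchmidtNormed, inner_smul_left, inner_smul_right, this, mul_zero]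
  · intro k
    have h1 : q k ∈ Submodule.span ℂ (Set.range (g (cls k))) := by
      rw [hspan]; exact Submodule.subset_span ⟨k, by simp [f]⟩
    refine Submodule.span_le.2 ?_ h1
    rintro _ ⟨l, rfl⟩
    by_cases hl : cls l = cls k
    · exact Submodule.subset_span ⟨l, hl, by simp only [hl]⟩
    · rw [hg0 _ _ hl]; exact Submodule.zero_mem _

/-- Among all families of rows that are supported in `QS` and partially orthonormal within every
class, some family yields projections at least as good as every product of block factors. -/
lemma exists_optimal_rows (cls : Fin n → C) (m : ℕ) (PS : ℕ → Fin n → Prop)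
    [∀ i, DecidablePred (PS i)] (QS : Fin n → Fin p → Prop)
    (hP : ∀ k l, cls k = cls l → ∀ i, PS i k → PS i l)
    (hQ : ∀ k l, cls k = cls l → ∀ j, QS k j → QS l j)
    (hPQ : ∀ i j k l, PS i k → PS i l → QS k j → QS l j → cls k = cls l)
    (a : ℕ → EuclideanSpace ℂ (Fin p)) :
    ∃ y : Fin n → EuclideanSpace ℂ (Fin p), (∀ k j, y k j ≠ 0 → QS k j) ∧
      (∀ i, PartialOrthonormal (univ.filter (PS i)) y) ∧
      ∀ x : ℕ → Fin n → ℂ, (∀ i k, x i k ≠ 0 → PS i k) →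
      ∀ q : Fin n → EuclideanSpace ℂ (Fin p), (∀ k j, q k j ≠ 0 → QS k j) →
        ∑ i ∈ range m, ‖a i - ∑ k with PS i k, inner ℂ (y k) (a i) • y k‖ ^ 2 ≤
          ∑ i ∈ range m, ‖a i - ∑ k, x i k • q k‖ ^ 2 := by
  classical
  let S : Set (Fin n → EuclideanSpace ℂ (Fin p)) :=
    {y | (∀ k j, ¬ QS k j → y k j = 0) ∧ (∀ k, ‖y k‖ * (‖y k‖ - 1) = 0) ∧
      (∀ k l, cls k = cls l → k ≠ l → inner ℂ (y k) (y l) = 0)}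
  have hunit : ∀ y ∈ S, ∀ k, y k = 0 ∨ ‖y k‖ = 1 := by
    intro y hy k
    rcases mul_eq_zero.1 (hy.2.1 k) with h | h
    · exact Or.inl (norm_eq_zero.1 h)
    · exact Or.inr (by linarith)
  have hclosed : IsClosed S := by
    simp only [S, Set.ofPred_and, Set.ofPred_forall]
    refine IsClosed.inter ?_ (IsClosed.inter ?_ ?_)
    · exact isClosed_iInter fun k => isClosed_iInter fun j => isClosed_iInter fun _ =>
        isClosed_eq (by fun_prop) continuous_const
    · exact isClosed_iInter fun k => isClosed_eq (by fun_prop) continuous_const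
    · exact isClosed_iInter fun k => isClosed_iInter fun j => isClosed_iInter fun _ =>
        isClosed_iInter fun _ => isClosed_eq (by fun_prop) continuous_const
  have hbdd : Bornology.IsBounded S := by
    refine (Metric.isBounded_closedBall (x := 0) (r := 1)).subset fun y hy => ?_
    rw [mem_closedBall_zero_iff, pi_norm_le_iff_of_nonneg zero_le_one]
    intro k
    rcases hunit y hy k with h | h
    · simp [h]
    · exact h.le
  have hcomp : IsCompact S := Metric.isCompact_of_isClosed_isBounded hclosed hbdd
  have hne : S.Nonempty := ⟨0, by simp [S]⟩
  have hcont : Continuous fun y : Fin n → EuclideanSpace ℂ (Fin p) =>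
      ∑ i ∈ range m, ‖a i - ∑ k with PS i k, inner ℂ (y k) (a i) • y k‖ ^ 2 := by
    fun_prop
  have horth : ∀ y ∈ S, ∀ i, PartialOrthonormal (univ.filter (PS i)) y := by
    intro y hy i
    refine ⟨fun k _ => hunit y hy k, fun k hk l hl hkl => ?_⟩
    by_cases hc : cls k = cls l
    · exact hy.2.2 k l hc hkl
    · rw [PiLp.inner_apply]
      refine sum_eq_zero fun j _ => ?_
      by_cases hkj : QS k j
      · have : ¬ QS l j := fun hlj =>
          hc (hPQ i j k l (mem_filter.1 hk).2 (mem_filter.1 hl).2 hkj hlj)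
        rw [hy.1 l j this, inner_zero_right]
      · rw [hy.1 k j hkj, inner_zero_left]
  obtain ⟨y, hyS, hmin⟩ := hcomp.exists_isMinOn hne hcont.continuousOn
  refine ⟨y, fun k j h => by_contra fun hn => h (hyS.1 k j hn), horth y hyS, ?_⟩
  intro x hx q hq
  obtain ⟨z, hz1, hz2, hz3, hz4⟩ := exists_rows_span cls QS hQ q hq
  have hzS : z ∈ S := by
    refine ⟨fun k j h => by_contra fun hn => h (hz1 k j hn), fun k => ?_, hz3⟩
    rcases hz2 k with h | h <;> simp [h]
  refine (hmin hzS).trans (sum_le_sum fun i _ => ?_)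
  refine pow_le_pow_left₀ (norm_nonneg _) ((horth z hzS i).norm_sub_proj_le (a i) ?_) 2
  refine Submodule.sum_mem _ fun k _ => ?_
  by_cases hxk : x i k = 0
  · simp [hxk]
  · refine Submodule.smul_mem _ _ (Submodule.span_mono ?_ (hz4 k))
    refine Set.image_mono fun l hl => ?_
    simpa using hP k l hl.symm i (hx i k hxk)

end Existence
section Arrays

variable {m n p : ℕ}

/-- The array `X` vanishes outside the relation `R`. -/
def SuppOn (R : ℕ → ℕ → Prop) (X : ℕ → ℕ → ℂ) : Prop := ∀ i j, X i j ≠ 0 → R i j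

/-- The first `p` entries of a row, as a Euclidean vector. -/
def row (p : ℕ) (f : ℕ → ℕ → ℂ) (i : ℕ) : EuclideanSpace ℂ (Fin p) :=
  WithLp.toLp 2 fun j => f i j

/-- The upper left `m × p` corner of an array, as a Euclidean vector of rows. -/
def corner (m p : ℕ) (f : ℕ → ℕ → ℂ) : PiLp 2 fun _ : Fin m => EuclideanSpace ℂ (Fin p) :=
  WithLp.toLp 2 fun i => row p f i

lemma SuppOn.suppIn {R : ℕ → ℕ → Prop} {X : ℕ → ℕ → ℂ} (hX : SuppOn R X)
    (hR : ∀ i j, R i j → i < m ∧ j < n) : SuppIn m n X :=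
  fun i j h => hR i j (hX i j h)

lemma SuppIn.sub {f g : ℕ → ℕ → ℂ} (hf : SuppIn m p f) (hg : SuppIn m p g) :
    SuppIn m p (f - g) := by
  intro i j h
  by_cases h0 : f i j = 0
  · refine hg i j fun h1 => h ?_
    simp [h0, h1]
  · exact hf i j h0

lemma SuppOn.nmul {R S T : ℕ → ℕ → Prop} {X Y : ℕ → ℕ → ℂ} (hX : SuppOn R X) (hY : SuppOn S Y)
    (h : ∀ i j k, R i k → S k j → T i j) : SuppOn T (nmul X Y) := by
  intro i j hij
  by_contra hT
  apply hij
  have : ∀ k, X i k * Y k j = 0 := by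
    intro k
    by_contra hk
    exact hT (h i j k (hX _ _ (left_ne_zero_of_mul hk)) (hY _ _ (right_ne_zero_of_mul hk)))
  simp [_root_.nmul, this]

lemma nmul_apply {X Y : ℕ → ℕ → ℂ} (hX : SuppIn m n X) (i j : ℕ) :
    nmul X Y i j = ∑ k : Fin n, X i k * Y k j := by
  rw [Fin.sum_univ_eq_sum_range (fun k => X i k * Y k j), nmul]
  refine tsum_eq_sum fun k hk => ?_
  have : X i k = 0 := by
    by_contra h
    exact hk (mem_range.2 (hX i k h).2)
  rw [this, zero_mul]

lemma row_nmul {X Y : ℕ → ℕ → ℂ} (hX : SuppIn m n X) (i : ℕ) :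
    row p (nmul X Y) i = ∑ k : Fin n, X i k • row p Y k := by
  ext j
  simp [row, nmul_apply hX]

lemma nfrob_eq_norm {f : ℕ → ℕ → ℂ} (hf : SuppIn m p f) : nfrob f = ‖corner m p f‖ := by
  have h1 : ∀ i, ∑' j, ‖f i j‖ ^ 2 = ‖row p f i‖ ^ 2 := by
    intro i
    rw [EuclideanSpace.norm_sq_eq, tsum_eq_sum (s := range p)]
    · exact (Fin.sum_univ_eq_sum_range (fun j => ‖f i j‖ ^ 2) p).symm
    · intro j hj
      have : f i j = 0 := by
        by_contra h
        exact hj (mem_range.2 (hf i j h).2)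
      simp [this]
  rw [PiLp.norm_eq_of_L2, nfrob]
  congr 1
  simp only [h1]
  rw [tsum_eq_sum (s := range m)]
  · exact (Fin.sum_univ_eq_sum_range (fun i => ‖row p f i‖ ^ 2) m).symm
  · intro i hi
    have : row p f i = 0 := by
      ext j
      by_contra h
      exact hi (mem_range.2 (hf i j h).1)
    simp [this]

lemma nfrob_sq {f : ℕ → ℕ → ℂ} (hf : SuppIn m p f) :
    nfrob f ^ 2 = ∑ i ∈ range m, ‖row p f i‖ ^ 2 := by
  rw [nfrob_eq_norm hf, PiLp.norm_sq_eq_of_L2]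
  exact Fin.sum_univ_eq_sum_range (fun i => ‖row p f i‖ ^ 2) m

lemma nfrob_nonneg (f : ℕ → ℕ → ℂ) : 0 ≤ nfrob f := Real.sqrt_nonneg _

lemma nfrob_sub_le {f g h : ℕ → ℕ → ℂ} (hf : SuppIn m p f) (hg : SuppIn m p g)
    (hh : SuppIn m p h) : nfrob (f - h) ≤ nfrob (f - g) + nfrob (g - h) := by
  rw [nfrob_eq_norm (SuppIn.sub hf hh), nfrob_eq_norm (SuppIn.sub hf hg),
    nfrob_eq_norm (SuppIn.sub hg hh)]
  exact norm_sub_le_norm_sub_add_norm_sub (corner m p f) (corner m p g) (corner m p h)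

open Classical in
/-- The product `N * Yᴴ`, restricted to the entries allowed by `P`. -/
def compress (P : ℕ → ℕ → Prop) (p : ℕ) (N Y : ℕ → ℕ → ℂ) : ℕ → ℕ → ℂ := fun i k =>
  if P i k then inner ℂ (row p Y k) (row p N i) else 0

lemma suppOn_compress (P : ℕ → ℕ → Prop) (N Y : ℕ → ℕ → ℂ) : SuppOn P (compress P p N Y) := by
  intro i k h
  by_contra hP
  exact h (if_neg hP)

lemma compress_sub (P : ℕ → ℕ → Prop) (M N Y : ℕ → ℕ → ℂ) :
    compress P p (M - N) Y = compress P p M Y - compress P p N Y := by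
  funext i k
  have : row p (M - N) i = row p M i - row p N i := rfl
  by_cases h : P i k <;> simp [compress, h, this]

lemma compress_nmul {P R S T Q : ℕ → ℕ → Prop} {X Z Y : ℕ → ℕ → ℂ} (hX : SuppOn R X)
    (hXb : SuppIn m n X) (hZ : SuppOn S Z) (hY : SuppOn Q Y)
    (hcomp : ∀ i t k, R i t → T t k → P i k)
    (hkey : ∀ i t k j, R i t → S t j → P i k → Q k j → T t k) :
    compress P p (nmul X Z) Y = nmul X (compress T p Z Y) := by
  funext i k
  rw [nmul_apply hXb, compress]
  split_ifs with hP
  · rw [row_nmul hXb, inner_sum]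
    refine sum_congr rfl fun t _ => ?_
    rw [inner_smul_right]
    by_cases hx : X i t = 0
    · simp [hx]
    congr 1
    rw [compress]
    split_ifs with hT
    · rfl
    · rw [PiLp.inner_apply]
      refine sum_eq_zero fun j _ => ?_
      by_contra hne
      refine hT (hkey i t k j (hX i t hx) (hZ t j fun h => hne ?_) hP (hY k j fun h => hne ?_)) <;>
        simp [row, h]
  · symm
    refine sum_eq_zero fun t _ => ?_
    by_cases hx : X i t = 0
    · simp [hx]
    · rw [compress, if_neg fun hT => hP (hcomp i t k (hX i t hx) hT), mul_zero]

/-- The rows of `Y` that meet a given row of `P` are partially orthonormal. -/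
def RowOrthonormal (P : ℕ → ℕ → Prop) (n p : ℕ) (Y : ℕ → ℕ → ℂ) : Prop :=
  ∀ i, ∀ s : Finset (Fin n), (∀ k ∈ s, P i k) → PartialOrthonormal s fun k => row p Y k

variable {P Q : ℕ → ℕ → Prop} {Y : ℕ → ℕ → ℂ}

lemma RowOrthonormal.nfrob_nmul_le (hY : RowOrthonormal P n p Y)
    (hP : ∀ i k, P i k → i < m ∧ k < n) (hQ : ∀ k j, Q k j → k < n ∧ j < p) (hYQ : SuppOn Q Y)
    {M : ℕ → ℕ → ℂ} (hM : SuppOn P M) : nfrob (nmul M Y) ≤ nfrob M := by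
  classical
  have hMb : SuppIn m n M := hM.suppIn hP
  have hb : SuppIn m p (nmul M Y) :=
    hM.nmul hYQ fun i j k h1 h2 => ⟨(hP i k h1).1, (hQ k j h2).2⟩
  refine (sq_le_sq₀ (nfrob_nonneg _) (nfrob_nonneg _)).1 ?_
  rw [nfrob_sq hb, nfrob_sq hMb]
  refine sum_le_sum fun i _ => ?_
  have hz : ∀ k : Fin n, k ∉ univ.filter (fun k : Fin n => P i k) → M i k = 0 := by
    intro k hk
    by_contra h
    exact hk (by simpa using hM i k h)
  rw [row_nmul hMb, EuclideanSpace.norm_sq_eq (row n M i),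
    ← sum_subset (subset_univ (univ.filter fun k : Fin n => P i k))
      (fun k _ hk => by rw [hz k hk, zero_smul])]
  refine ((hY i (univ.filter fun k : Fin n => P i k) (by simp)).norm_sum_sq_le fun k => M i k).trans ?_
  exact sum_le_sum_of_subset_of_nonneg (subset_univ _) fun _ _ _ => by positivity

lemma RowOrthonormal.nfrob_compress_le (hY : RowOrthonormal P n p Y)
    (hP : ∀ i k, P i k → i < m ∧ k < n) {N : ℕ → ℕ → ℂ} (hN : SuppIn m p N) :
    nfrob (compress P p N Y) ≤ nfrob N := by
  classical
  refine (sq_le_sq₀ (nfrob_nonneg _) (nfrob_nonneg _)).1 ?_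
  rw [nfrob_sq ((suppOn_compress P N Y).suppIn hP), nfrob_sq hN]
  refine sum_le_sum fun i _ => ?_
  refine le_trans (le_of_eq ?_)
    ((hY i (univ.filter fun k : Fin n => P i k) (by simp)).sum_norm_inner_sq_le (row p N i))
  rw [EuclideanSpace.norm_sq_eq, sum_filter]
  refine sum_congr rfl fun k _ => ?_
  by_cases h : P i k <;> simp [row, compress, h]

/-- The optimal right factor of a two-factor problem can be chosen with partially orthonormal
rows, the left factor being a compression of the target. -/
lemma exists_right_factor (hP : ∀ i k, P i k → i < m ∧ k < n)
    (hQ : ∀ k j, Q k j → k < n ∧ j < p)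
    (hPQ : ∀ i j k l, P i k → P i l → Q k j → Q l j →
      (∀ i', P i' k ↔ P i' l) ∧ ∀ j', Q k j' ↔ Q l j')
    {A : ℕ → ℕ → ℂ} (hA : SuppIn m p A) :
    ∃ Y, SuppOn Q Y ∧ RowOrthonormal P n p Y ∧ ∀ X Z, SuppOn P X → SuppOn Q Z →
      nfrob (A - nmul (compress P p A Y) Y) ≤ nfrob (A - nmul X Z) := by
  classical
  obtain ⟨y, hy1, hy2, hy3⟩ := exists_optimal_rows
    (fun k : Fin n => ((fun i => P i k, fun j => Q k j) : (ℕ → Prop) × (ℕ → Prop)))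
    m (fun i k => P i k) (fun k (j : Fin p) => Q k j)
    (fun k l h i hk => by
      have := congrFun (congrArg Prod.fst h) i
      exact this.mp hk)
    (fun k l h j hk => by
      have := congrFun (congrArg Prod.snd h) j
      exact this.mp hk)
    (fun i j k l h1 h2 h3 h4 => by
      obtain ⟨h5, h6⟩ := hPQ i j k l h1 h2 h3 h4
      exact Prod.ext (funext fun i' => propext (h5 i')) (funext fun j' => propext (h6 j')))
    (row p A)
  let Y : ℕ → ℕ → ℂ := fun k j => if h : k < n ∧ j < p then y ⟨k, h.1⟩ ⟨j, h.2⟩ else 0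
  have hrow : ∀ k : Fin n, row p Y k = y k := by
    intro k
    ext j
    simp [row, Y]
  have hYQ : SuppOn Q Y := by
    intro k j h
    by_cases hkj : k < n ∧ j < p
    · simp only [Y, hkj, and_self, dif_pos] at h
      exact hy1 ⟨k, hkj.1⟩ ⟨j, hkj.2⟩ h
    · exact absurd (dif_neg hkj) h
  have hbound : ∀ X Z, SuppOn P X → SuppOn Q Z → SuppIn m p (nmul X Z) := fun X Z hX hZ =>
    hX.nmul hZ fun i j k h1 h2 => ⟨(hP i k h1).1, (hQ k j h2).2⟩
  refine ⟨Y, hYQ, ?_, ?_⟩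
  · intro i s hs
    have hi := hy2 i
    have hsub : ∀ k ∈ s, k ∈ univ.filter (fun k : Fin n => P i k) := fun k hk => by
      simpa using hs k hk
    simp only [PartialOrthonormal, hrow]
    exact ⟨fun k hk => hi.1 k (hsub k hk), fun k hk l hl => hi.2 k (hsub k hk) l (hsub l hl)⟩
  · intro X Z hX hZ
    have hc := suppOn_compress (p := p) P A Y
    refine (sq_le_sq₀ (nfrob_nonneg _) (nfrob_nonneg _)).1 ?_
    rw [nfrob_sq (SuppIn.sub hA (hbound _ _ hc hYQ)), nfrob_sq (SuppIn.sub hA (hbound X Z hX hZ))]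
    have hsub : ∀ M N i, row p (M - N) i = row p M i - row p N i := fun _ _ _ => rfl
    simp only [hsub, row_nmul (hX.suppIn hP), row_nmul (hc.suppIn hP), hrow]
    refine le_trans (le_of_eq ?_)
      (hy3 (fun i k => X i k) (fun i k => hX i k) (fun k => row p Z k) fun k j => hZ k j)
    refine sum_congr rfl fun i _ => ?_
    rw [sum_filter]
    congr 3
    refine sum_congr rfl fun k _ => ?_
    by_cases h : P i k <;> simp [compress, h, hrow]

end Arrays
section Patterns

lemma spatN_ne_zero_iff (π : Pattern) (i j : ℕ) : SpatN π i j ≠ 0 ↔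
    i < π.rows ∧ j < π.cols ∧ i / (π.b * π.d) = j / (π.c * π.d) ∧ i % π.d = j % π.d := by
  by_cases h : i < π.rows ∧ j < π.cols
  · have hi := h.1
    have hj := h.2
    have hS : SpatN π i j =
        (1 : Matrix (Fin π.a) (Fin π.a) ℕ) ((kron3Equiv π.a π.b π.d).symm ⟨i, hi⟩).1.1
          ((kron3Equiv π.a π.c π.d).symm ⟨j, hj⟩).1.1 * 1 *
        (1 : Matrix (Fin π.d) (Fin π.d) ℕ) ((kron3Equiv π.a π.b π.d).symm ⟨i, hi⟩).2
          ((kron3Equiv π.a π.c π.d).symm ⟨j, hj⟩).2 := dif_pos h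
    have e1 : ∀ (a b d : ℕ) (x : Fin (a * b * d)),
        (((kron3Equiv a b d).symm x).1.1 : ℕ) = x / (b * d) := by
      intro a b d x
      simp [kron3Equiv, Fin.divNat, Nat.div_div_eq_div_mul, mul_comm]
    have e2 : ∀ (a b d : ℕ) (x : Fin (a * b * d)),
        (((kron3Equiv a b d).symm x).2 : ℕ) = x % d := by
      intro a b d x
      simp [kron3Equiv, Fin.modNat]
    have f1 := e1 π.a π.b π.d ⟨i, hi⟩
    have f2 := e1 π.a π.c π.d ⟨j, hj⟩
    have g1 := e2 π.a π.b π.d ⟨i, hi⟩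
    have g2 := e2 π.a π.c π.d ⟨j, hj⟩
    simp only at f1 f2 g1 g2
    rw [hS, Matrix.one_apply, Matrix.one_apply, ← f1, ← f2, ← g1, ← g2, ← Fin.ext_iff,
      ← Fin.ext_iff]
    simp [h.1, h.2, and_comm]
  · simp only [SpatN, dif_neg h, ne_eq, not_true_eq_false, false_iff]
    tauto

/-- Consecutive patterns of an architecture with `L` positive patterns are chainable. -/
def IsChain (π : ℕ → Pattern) (L : ℕ) : Prop :=
  (∀ ℓ < L, (π ℓ).Pos) ∧ ∀ ℓ, ℓ + 1 < L → Pattern.Chainable (π ℓ) (π (ℓ + 1))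

variable {π : ℕ → Pattern} {L : ℕ}

lemma IsChain.mono (h : IsChain π L) {M : ℕ} (hM : M ≤ L) : IsChain π M :=
  ⟨fun ℓ hl => h.1 ℓ (by omega), fun ℓ hl => h.2 ℓ (by omega)⟩

lemma IsChain.a_dvd (h : IsChain π L) {s t : ℕ} (hst : s ≤ t) (ht : t < L) :
    (π s).a ∣ (π t).a := by
  induction t, hst using Nat.le_induction with
  | base => rfl
  | succ t _ ih => exact (ih (by omega)).trans (h.2 t ht).2.2.2.2.1

lemma IsChain.d_dvd (h : IsChain π L) {s t : ℕ} (hst : s ≤ t) (ht : t < L) :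
    (π t).d ∣ (π s).d := by
  induction t, hst using Nat.le_induction with
  | base => rfl
  | succ t _ ih => exact (h.2 t ht).2.2.2.2.2.trans (ih (by omega))

lemma IsChain.cols_eq (h : IsChain π L) {t : ℕ} (ht : t + 1 < L) :
    (π t).cols = (π (t + 1)).rows := by
  obtain ⟨⟨r, hr⟩, ⟨r', hr'⟩, heq, -, -, -⟩ := h.2 t ht
  rw [hr, hr', Nat.mul_div_cancel_left _ (h.1 (t + 1) ht).1,
    Nat.mul_div_cancel_left _ (h.1 t (by omega)).2.2.2] at heq
  subst heq
  rw [Pattern.cols, Pattern.rows, hr, mul_assoc ((π (t + 1)).a) ((π (t + 1)).b), hr']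
  ring

lemma IsChain.pprod_spec (h : IsChain π L) (q k : ℕ) (hk : q + k < L) :
    (pprod π q k).a = (π q).a ∧ (pprod π q k).d = (π (q + k)).d ∧
      (pprod π q k).b * (pprod π q k).d = (π q).b * (π q).d ∧
      (pprod π q k).a * (pprod π q k).c = (π (q + k)).a * (π (q + k)).c := by
  induction k with
  | zero => exact ⟨rfl, rfl, rfl, rfl⟩
  | succ k ih =>
    obtain ⟨h1, h2, h3, -⟩ := ih (by omega)
    refine ⟨h1, rfl, ?_, ?_⟩
    · change (pprod π q k).b * (pprod π q k).d / (π (q + k + 1)).d * (π (q + k + 1)).d = _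
      rw [h3, Nat.div_mul_cancel]
      exact (h.d_dvd (s := q) (by omega) hk).mul_left _
    · change (pprod π q k).a * ((π (q + k + 1)).a * (π (q + k + 1)).c / (pprod π q k).a) = _
      rw [h1, Nat.mul_div_cancel']
      · rfl
      · exact (h.a_dvd (s := q) (by omega) hk).mul_right _

/-- The support of the partial product of the patterns `π s, …, π t`. -/
def ChainSupp (π : ℕ → Pattern) (s t i j : ℕ) : Prop :=
  i < (π s).rows ∧ j < (π t).cols ∧ i / ((π s).rows / (π s).a) = j / ((π t).cols / (π s).a) ∧
    i % (π t).d = j % (π t).d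

lemma IsChain.isFactorN_iff (h : IsChain π L) {s k : ℕ} (hk : s + k < L) (X : ℕ → ℕ → ℂ) :
    IsFactorN (pprod π s k) X ↔ SuppOn (ChainSupp π s (s + k)) X := by
  have key : ∀ i j, SpatN (pprod π s k) i j ≠ 0 ↔ ChainSupp π s (s + k) i j := by
    intro i j
    obtain ⟨h1, h2, h3, h4⟩ := h.pprod_spec s k hk
    have ha : 0 < (π s).a := (h.1 s (by omega)).1
    have hr : (pprod π s k).rows = (π s).rows := by
      rw [Pattern.rows, Pattern.rows, mul_assoc, h3, h1, mul_assoc]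
    have hc : (pprod π s k).cols = (π (s + k)).cols := by
      rw [Pattern.cols, Pattern.cols, h4, h2]
    have hb : (π s).rows / (π s).a = (pprod π s k).b * (pprod π s k).d := by
      rw [h3, Pattern.rows, mul_assoc, Nat.mul_div_cancel_left _ ha]
    have hd : (π (s + k)).cols / (π s).a = (pprod π s k).c * (pprod π s k).d := by
      rw [← hc, Pattern.cols, h1, mul_assoc, Nat.mul_div_cancel_left _ ha]
    rw [spatN_ne_zero_iff, ChainSupp, hr, hc, hb, hd, h2]
  constructor
  · intro hX i j hij
    rw [← key]
    exact fun h0 => hij (hX i j h0)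
  · intro hX i j h0
    by_contra hij
    exact (key i j).2 (hX i j hij) h0

lemma div_eq_div_of_dvd {a a' M N x y : ℕ} (ha : a ∣ a') (hM : a' ∣ M) (hN : a' ∣ N)
    (h : x / (M / a') = y / (N / a')) : x / (M / a) = y / (N / a) := by
  have : ∀ K, a' ∣ K → K / a = K / a' * (a' / a) := by
    rintro _ ⟨w, rfl⟩
    rcases Nat.eq_zero_or_pos a' with h0 | h0
    · simp [h0]
    · rw [Nat.mul_div_cancel_left _ h0, ← Nat.mul_div_assoc _ ha, mul_comm]
  rw [this M hM, this N hN, ← Nat.div_div_eq_div_mul, ← Nat.div_div_eq_div_mul, h]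

lemma IsChain.dvd_rows (h : IsChain π L) {s t : ℕ} (hst : s ≤ t) (ht : t < L) :
    (π s).a ∣ (π t).rows := by
  rw [Pattern.rows, mul_assoc]
  exact (h.a_dvd hst ht).mul_right _

lemma IsChain.dvd_cols (h : IsChain π L) {s t : ℕ} (hst : s ≤ t) (ht : t < L) :
    (π s).a ∣ (π t).cols := by
  rw [Pattern.cols, mul_assoc]
  exact (h.a_dvd hst ht).mul_right _

lemma mod_eq_of_dvd {d e x y : ℕ} (hde : d ∣ e) (h : x % e = y % e) : x % d = y % d := by
  rw [← Nat.mod_mod_of_dvd x hde, h, Nat.mod_mod_of_dvd y hde]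

lemma IsChain.supp_comp (h : IsChain π L) {s t u i j k : ℕ} (hst : s ≤ t) (htu : t < u)
    (hu : u < L) (h1 : ChainSupp π s t i k) (h2 : ChainSupp π (t + 1) u k j) :
    ChainSupp π s u i j := by
  refine ⟨h1.1, h2.2.1, ?_, (mod_eq_of_dvd (h.d_dvd htu.le hu) h1.2.2.2).trans h2.2.2.2⟩
  rw [h1.2.2.1, h.cols_eq (by omega)]
  exact div_eq_div_of_dvd (h.a_dvd (by omega) (by omega)) (h.dvd_rows le_rfl (by omega))
    (h.dvd_cols (by omega) hu) h2.2.2.1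

lemma IsChain.supp_cancel (h : IsChain π L) {s n i t k j : ℕ} (hsn : s < n) (hn : n + 1 < L)
    (h1 : ChainSupp π 0 s i t) (h2 : ChainSupp π (s + 1) (n + 1) t j)
    (h3 : ChainSupp π 0 n i k) (h4 : ChainSupp π (n + 1) (n + 1) k j) :
    ChainSupp π (s + 1) n t k := by
  refine ⟨h2.1, h3.2.1, ?_, ?_⟩
  · rw [h2.2.2.1, h.cols_eq hn]
    exact (div_eq_div_of_dvd (h.a_dvd (by omega) hn) (h.dvd_rows le_rfl hn)
      (h.dvd_cols le_rfl hn) h4.2.2.1).symm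
  · rw [← h3.2.2.2]
    exact (mod_eq_of_dvd (h.d_dvd hsn.le (by omega)) h1.2.2.2).symm

lemma chainSupp_class {n i j k l : ℕ}
    (h1 : ChainSupp π 0 n i k) (h2 : ChainSupp π 0 n i l)
    (h3 : ChainSupp π (n + 1) (n + 1) k j) (h4 : ChainSupp π (n + 1) (n + 1) l j) :
    (∀ i', ChainSupp π 0 n i' k ↔ ChainSupp π 0 n i' l) ∧
      ∀ j', ChainSupp π (n + 1) (n + 1) k j' ↔ ChainSupp π (n + 1) (n + 1) l j' := by
  have hmod : k % (π n).d = l % (π n).d := h1.2.2.2.symm.trans h2.2.2.2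
  have hmod' := h3.2.2.2.trans h4.2.2.2.symm
  have hdiv := h1.2.2.1.symm.trans h2.2.2.1
  have hdiv' := h3.2.2.1.trans h4.2.2.1.symm
  refine ⟨fun i' => ?_, fun j' => ?_⟩
  · simp only [ChainSupp, hmod, hdiv, h1.2.1, h2.2.1]
  · simp only [ChainSupp, hmod', hdiv', h3.1, h4.1]

end Patterns

section Errors

variable {A : ℕ → ℕ → ℂ} {p q : Pattern}

lemma Eerr_pairArch_le {X Y : ℕ → ℕ → ℂ} (hX : IsFactorN p X) (hY : IsFactorN q Y) :
    Eerr (pairArch p q) 2 A ≤ nfrob (A - nmul X Y) := by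
  refine csInf_le ⟨0, ?_⟩ ⟨nmul X Y, ⟨fun ℓ => if ℓ = 0 then X else Y, ?_, rfl⟩, rfl⟩
  · rintro _ ⟨B, -, rfl⟩
    exact nfrob_nonneg _
  · intro ℓ _
    by_cases h : ℓ = 0 <;> simp [pairArch, h, hX, hY]

lemma le_Eerr_pairArch {c : ℝ}
    (h : ∀ X Y, IsFactorN p X → IsFactorN q Y → c ≤ nfrob (A - nmul X Y)) :
    c ≤ Eerr (pairArch p q) 2 A := by
  refine le_csInf ⟨_, nprod 0 1, ⟨0, fun _ _ _ _ _ => rfl, rfl⟩, rfl⟩ ?_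
  rintro _ ⟨_, ⟨X, hX, rfl⟩, rfl⟩
  exact h (X 0) (X 1) (hX 0 (by norm_num)) (hX 1 (by norm_num))

variable {π : ℕ → Pattern} {L : ℕ}

lemma IsChain.suppOn_nprod (h : IsChain π L) {n : ℕ} (hn : n < L) {X : ℕ → ℕ → ℕ → ℂ}
    (hX : ∀ ℓ ≤ n, SuppOn (ChainSupp π ℓ ℓ) (X ℓ)) : SuppOn (ChainSupp π 0 n) (nprod X n) := by
  induction n with
  | zero => exact hX 0 le_rfl
  | succ n ih =>
    exact (ih (by omega) fun ℓ hl => hX ℓ (by omega)).nmul (hX (n + 1) le_rfl)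
      fun i j k h1 h2 => h.supp_comp (by omega) (by omega) hn h1 h2

lemma nprod_congr {X Y : ℕ → ℕ → ℕ → ℂ} {n : ℕ} (h : ∀ ℓ ≤ n, X ℓ = Y ℓ) :
    nprod X n = nprod Y n := by
  induction n with
  | zero => exact h 0 le_rfl
  | succ n ih => rw [nprod, nprod, ih fun ℓ hl => h ℓ (by omega), h (n + 1) le_rfl]

/-- Compressing the target by an optimal last factor does not increase the split errors. -/
lemma IsChain.Esplit_compress_le (h : IsChain π L) {n s : ℕ} (hn : n + 1 < L) (hs : 1 ≤ s)
    (hsn : s ≤ n) {Y : ℕ → ℕ → ℂ} (hY : SuppOn (ChainSupp π (n + 1) (n + 1)) Y)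
    (hYo : RowOrthonormal (ChainSupp π 0 n) (π n).cols (π (n + 1)).cols Y)
    (hA : SuppIn (π 0).rows (π (n + 1)).cols A) :
    Esplit π (n + 1) s (compress (ChainSupp π 0 n) (π (n + 1)).cols A Y) ≤
      Esplit π (n + 2) s A := by
  obtain ⟨s, rfl⟩ : ∃ t, s = t + 1 := ⟨s - 1, by omega⟩
  refine le_Eerr_pairArch fun X Z hX hZ => ?_
  have e1 : s + 1 + (n + 2 - 1 - (s + 1)) = n + 1 := by omega
  have e2 : s + 1 + (n + 1 - 1 - (s + 1)) = n := by omega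
  have e3 : 0 + (s + 1 - 1) = s := by omega
  have hX' := (h.isFactorN_iff (by omega) X).1 hX
  have hZ' := (h.isFactorN_iff (by omega) Z).1 hZ
  rw [e3] at hX'
  rw [e1] at hZ'
  have hXb : SuppIn (π 0).rows (π s).cols X := hX'.suppIn fun i j hij => ⟨hij.1, hij.2.1⟩
  have hW : IsFactorN (pprod π (s + 1) (n + 1 - 1 - (s + 1)))
      (compress (ChainSupp π (s + 1) n) (π (n + 1)).cols Z Y) := by
    rw [h.isFactorN_iff (by omega), e2]
    exact suppOn_compress _ _ _
  refine (Eerr_pairArch_le hX hW).trans ?_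
  have hXZ : compress (ChainSupp π 0 n) (π (n + 1)).cols (nmul X Z) Y =
      nmul X (compress (ChainSupp π (s + 1) n) (π (n + 1)).cols Z Y) :=
    compress_nmul hX' hXb hZ' hY
      (fun i t k h1 h2 => h.supp_comp (by omega) (by omega) (by omega) h1 h2)
      (fun i t k j h1 h2 h3 h4 => h.supp_cancel (by omega) hn h1 h2 h3 h4)
  rw [← hXZ, ← compress_sub]
  refine hYo.nfrob_compress_le (fun i k hik => ⟨hik.1, hik.2.1⟩) (SuppIn.sub hA ?_)
  exact hX'.nmul hZ' fun i j k h1 h2 => ⟨h1.1, h2.2.1⟩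

lemma IsChain.exists_factors (n : ℕ) : ∀ A : ℕ → ℕ → ℂ, IsChain π (n + 1) →
    SuppIn (π 0).rows (π n).cols A → (n = 0 → SuppOn (ChainSupp π 0 0) A) →
    ∃ X : ℕ → ℕ → ℕ → ℂ, (∀ ℓ ≤ n, SuppOn (ChainSupp π ℓ ℓ) (X ℓ)) ∧
      nfrob (A - nprod X n) ≤ ∑ s ∈ Icc 1 n, Esplit π (n + 1) s A := by
  induction n with
  | zero =>
    intro A _ _ h0
    refine ⟨fun _ => A, fun ℓ hl => ?_, ?_⟩
    · obtain rfl : ℓ = 0 := by omega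
      exact h0 rfl
    · simp [nprod, nfrob]
  | succ n ih =>
    intro A h hA _
    have hPb : ∀ i k, ChainSupp π 0 n i k → i < (π 0).rows ∧ k < (π n).cols :=
      fun i k hik => ⟨hik.1, hik.2.1⟩
    have hQb : ∀ k j, ChainSupp π (n + 1) (n + 1) k j → k < (π n).cols ∧ j < (π (n + 1)).cols :=
      fun k j hkj => ⟨by rw [h.cols_eq (by omega)]; exact hkj.1, hkj.2.1⟩
    obtain ⟨Y, hY, hYo, hopt⟩ := exists_right_factor hPb hQb
      (fun i j k l h1 h2 h3 h4 => chainSupp_class h1 h2 h3 h4) hA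
    set A' := compress (ChainSupp π 0 n) (π (n + 1)).cols A Y with hA'
    have hA's : SuppOn (ChainSupp π 0 n) A' := suppOn_compress _ _ _
    obtain ⟨X, hX, hXe⟩ := ih A' (h.mono (by omega)) (hA's.suppIn hPb)
      (by rintro rfl; exact hA's)
    have hB : SuppOn (ChainSupp π 0 n) (nprod X n) := h.suppOn_nprod (by omega) hX
    refine ⟨Function.update X (n + 1) Y, fun ℓ hl => ?_, ?_⟩
    · rcases eq_or_ne ℓ (n + 1) with rfl | hne
      · simpa using hY
      · rw [Function.update_of_ne hne]
        exact hX ℓ (by omega)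
    have hprod : nprod (Function.update X (n + 1) Y) (n + 1) = nmul (nprod X n) Y := by
      rw [nprod, Function.update_self, nprod_congr fun ℓ hl => Function.update_of_ne (by omega) _ _]
    have hlast : nfrob (A - nmul A' Y) ≤ Esplit π (n + 2) (n + 1) A := by
      refine le_Eerr_pairArch fun X Z hX hZ => hopt X Z ?_ ?_
      · have := (h.isFactorN_iff (by omega) X).1 hX
        simpa using this
      · have := (h.isFactorN_iff (by omega) Z).1 hZ
        simpa using this
    have hbound : ∀ M, SuppOn (ChainSupp π 0 n) M →
        SuppIn (π 0).rows (π (n + 1)).cols (nmul M Y) := fun M hM =>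
      hM.nmul hY fun i j k h1 h2 => ⟨h1.1, h2.2.1⟩
    have hsub : nmul A' Y - nmul (nprod X n) Y = nmul (A' - nprod X n) Y := by
      funext i j
      rw [Pi.sub_apply, Pi.sub_apply, nmul_apply (hA's.suppIn hPb), nmul_apply (hB.suppIn hPb),
        nmul_apply (SuppIn.sub (hA's.suppIn hPb) (hB.suppIn hPb)), ← sum_sub_distrib]
      exact sum_congr rfl fun k _ => (sub_mul _ _ _).symm
    have hdiff : SuppOn (ChainSupp π 0 n) (A' - nprod X n) := by
      intro i k hik
      by_cases h0 : A' i k = 0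
      · exact hB i k fun h1 => hik (by simp [h0, h1])
      · exact hA's i k h0
    calc nfrob (A - nprod (Function.update X (n + 1) Y) (n + 1))
        ≤ nfrob (A - nmul A' Y) + nfrob (nmul A' Y - nmul (nprod X n) Y) := by
          rw [hprod]
          exact nfrob_sub_le hA (hbound A' hA's) (hbound _ hB)
      _ ≤ Esplit π (n + 2) (n + 1) A + nfrob (A' - nprod X n) := by
          rw [hsub]
          exact add_le_add hlast (hYo.nfrob_nmul_le hPb hQb hY hdiff)
      _ ≤ Esplit π (n + 2) (n + 1) A + ∑ s ∈ Icc 1 n, Esplit π (n + 2) s A := by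
          refine add_le_add le_rfl (hXe.trans (sum_le_sum fun s hs => ?_))
          rw [mem_Icc] at hs
          exact h.Esplit_compress_le (by omega) hs.1 hs.2 hY hYo hA
      _ = ∑ s ∈ Icc 1 (n + 1), Esplit π (n + 2) s A := by
          rw [sum_Icc_succ_top (by omega), add_comm]

end Errors

end Butterfly
end

/-- **Theorem (approximation error, arbitrary permutation).** For a non-redundant chainable
architecture of depth `L ≥ 2` and any target matrix `A`, there exist butterfly factors whose
product approximates `A` within `∑_{s=1}^{L-1} E^{β_s}(A)` in Frobenius norm. -/
theorem butterfly_error_sum (L : ℕ) (hL : 2 ≤ L) (π : ℕ → Pattern)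
    (hPos : ∀ ℓ < L, (π ℓ).Pos)
    (hch : ∀ ℓ, ℓ + 1 < L → Pattern.Chainable (π ℓ) (π (ℓ + 1)))
    (hnr : ∀ ℓ, ℓ + 1 < L → ¬ RedundantPair (π ℓ) (π (ℓ + 1)))
    (A : ℕ → ℕ → ℂ) (hA : SuppIn (π 0).rows (π (L - 1)).cols A) :
    ∃ X : ℕ → ℕ → ℕ → ℂ, (∀ ℓ < L, IsFactorN (π ℓ) (X ℓ)) ∧
      nfrob (A - nprod X (L - 1)) ≤ ∑ s ∈ Finset.Icc 1 (L - 1), Esplit π L s A := by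
  obtain ⟨n, rfl⟩ : ∃ n, L = n + 1 := ⟨L - 1, by omega⟩
  have h : Butterfly.IsChain π (n + 1) := ⟨hPos, hch⟩
  obtain ⟨X, hX, hXe⟩ := Butterfly.IsChain.exists_factors n A h hA (by omega)
  exact ⟨X, fun ℓ hl => (h.isFactorN_iff (s := ℓ) (k := 0) hl (X ℓ)).2 (hX ℓ (by omega)), hXe⟩
end
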